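/- arXiv:1207.4104 — 4 statements merged into one kernel-verified Lean document; each statement's English description precedes it below -/
import Mathlib

section
/- Let m ≥ 1 be a fixed integer and let n ≥ m. Let H be the random n×m Toeplitz matrix built from i.i.d. standard Gaussian N(0,1) inputs h_{-m+2},…,h_n. Then there exist constants c₁ > 0 and β > 0 such that, with probability at least 1 − e^{−c₁ n} for all n sufficiently large, H has the following property: for every x ∈ ℝ^m and every error vector e ∈ ℝ^n whose support K satisfies |K| ≤ β n, x is the unique minimizer of z ↦ ‖(Hx + e) − Hz‖₁ over z ∈ ℝ^m. Moreover β may be taken as any constant in (0,1) such that for some μ > 0 and 0 < δ < 1, β log(1/β) + (1−β) log(1/(1−β)) + mβ[log 2 + mμ²/2 + log Φ(μ√m)] + (1/(2m−1) − β)[log 2 + μ²(1−δ)²/2 + log(1 − Φ(μ(1−δ)))] < 0, where Φ is the standard Gaussian cumulative distribution function. -/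
open MeasureTheory ProbabilityTheory Finset Filter

noncomputable section

/-- The `n × m` Toeplitz matrix built from the input sequence
`h = (h_{-m+2}, …, h_n)`, reindexed as `h : Fin (n+m-1) → ℝ`;
the `(i,j)` entry (0-based) is the input with index `i + j`, which corresponds to
`H_{i,j} = h_{i-m+j}` in 1-based indexing. -/
def toeplitz (n m : ℕ) (h : Fin (n + m - 1) → ℝ) : Matrix (Fin n) (Fin m) ℝ :=
  fun i j => h ⟨i.1 + j.1, by have := i.2; have := j.2; omega⟩

/-- The ℓ¹ norm of a vector in `ℝ^k`. -/
def l1 {k : ℕ} (v : Fin k → ℝ) : ℝ := ∑ i, |v i|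

/-- The Euclidean (ℓ²) norm of a vector in `ℝ^k`. -/
def l2 {k : ℕ} (v : Fin k → ℝ) : ℝ := Real.sqrt (∑ i, (v i) ^ 2)

/-- Product of `d` i.i.d. standard Gaussian `N(0,1)` measures on `ℝ^d`. -/
def gaussPi (d : ℕ) : Measure (Fin d → ℝ) := Measure.pi fun _ => gaussianReal 0 1

/-- The standard Gaussian cumulative distribution function `Φ`. -/
def stdGaussianCDF (t : ℝ) : ℝ :=
  (Real.sqrt (2 * Real.pi))⁻¹ * ∫ x in Set.Iic t, Real.exp (-x ^ 2 / 2)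

open Classical in
/-- Number of nonzero entries of a vector. -/
def sparsity {k : ℕ} (v : Fin k → ℝ) : ℕ := (Finset.univ.filter fun i => v i ≠ 0).card

def Mg (a : ℝ) : ℝ := mgf (fun x : ℝ => |x|) (gaussianReal 0 1) a

lemma Mg_int (a : ℝ) : Integrable (fun x : ℝ => Real.exp (a * |x|)) (gaussianReal 0 1) := by
  apply integrable_exp_mul_abs
  · exact integrable_exp_mul_gaussianReal a
  · exact integrable_exp_mul_gaussianReal (-a)

lemma Mg_cont : Continuous Mg := continuous_mgf (fun t => Mg_int t)

lemma Mg_zero : Mg 0 = 1 := by simp [Mg]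

lemma Mg_pos (a : ℝ) : 0 < Mg a := mgf_pos (Mg_int a)

lemma Mg_mono {a b : ℝ} (h : a ≤ b) : Mg a ≤ Mg b := by
  unfold Mg mgf
  apply integral_mono (Mg_int a) (Mg_int b)
  intro x
  simp only
  gcongr

lemma Mg_eq (a : ℝ) : Mg a = 2 * Real.exp (a ^ 2 / 2) * stdGaussianCDF a := by
  unfold Mg mgf
  rw [integral_gaussianReal_eq_integral_smul (by norm_num)]
  have h1 : ∀ x : ℝ, gaussianPDFReal 0 1 x • Real.exp (a * |x|) =
      (fun y : ℝ => gaussianPDFReal 0 1 y * Real.exp (a * y)) |x| := by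
    intro x
    simp [gaussianPDFReal]
  simp_rw [h1]
  rw [integral_comp_abs (f := fun y : ℝ => gaussianPDFReal 0 1 y * Real.exp (a * y))]
  have h2 : ∀ y : ℝ, gaussianPDFReal 0 1 y * Real.exp (a * y) =
      (fun u : ℝ => Real.exp (a ^ 2 / 2) * (Real.sqrt (2 * Real.pi))⁻¹ *
        Real.exp (-(u + a) ^ 2 / 2)) (-y) := by
    intro y
    simp only [gaussianPDFReal]
    rw [mul_assoc, ← Real.exp_add, mul_comm (Real.exp (a ^ 2 / 2)), mul_assoc _ (Real.exp _), ← Real.exp_add]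
    simp only [NNReal.coe_one, mul_one, sub_zero]
    ring_nf
  simp_rw [h2]
  rw [integral_comp_neg_Ioi (0 : ℝ) (fun u : ℝ => Real.exp (a ^ 2 / 2) * (Real.sqrt (2 * Real.pi))⁻¹ *
        Real.exp (-(u + a) ^ 2 / 2))]
  rw [integral_const_mul]
  have h3 : ∫ u in Set.Iic (-(0:ℝ)), Real.exp (-(u + a) ^ 2 / 2) =
      ∫ u in Set.Iic a, Real.exp (-u ^ 2 / 2) := by
    have := (measurePreserving_add_right (volume : Measure ℝ) a).setIntegral_preimage_emb
      (measurableEmbedding_addRight a) (fun u => Real.exp (-u ^ 2 / 2)) (Set.Iic a)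
    rw [← this]
    simp
  rw [h3]
  unfold stdGaussianCDF
  ring

lemma cdf_neg (a : ℝ) : stdGaussianCDF (-a) = 1 - stdGaussianCDF a := by
  have hint : Integrable (fun x : ℝ => Real.exp (-x ^ 2 / 2)) := by
    have := integrable_exp_neg_mul_sq (b := 1/2) (by norm_num)
    refine this.congr (Eventually.of_forall fun x => ?_)
    simp only
    ring_nf
  have h1 : ∫ x in Set.Iic (-a), Real.exp (-x ^ 2 / 2) = ∫ x in Set.Ioi a, Real.exp (-x ^ 2 / 2) := by
    rw [← integral_comp_neg_Ioi a (fun x : ℝ => Real.exp (-x ^ 2 / 2))]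
    simp
  have h2 := intervalIntegral.integral_Iic_add_Ioi (b := a) (μ := volume) hint.integrableOn hint.integrableOn
  have h3 : ∫ x : ℝ, Real.exp (-x ^ 2 / 2) = Real.sqrt (2 * Real.pi) := by
    have := integral_gaussian (1/2)
    rw [show Real.pi / (1/2) = 2 * Real.pi by ring] at this
    rw [← this]
    congr 1
    ext x
    ring_nf
  rw [h3] at h2
  have h4 : Real.sqrt (2 * Real.pi) ≠ 0 := by positivity
  unfold stdGaussianCDF
  rw [h1]
  have h5 : ∫ x in Set.Ioi a, Real.exp (-x ^ 2 / 2) = Real.sqrt (2 * Real.pi) -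
    ∫ x in Set.Iic a, Real.exp (-x ^ 2 / 2) := by linarith
  rw [h5, mul_sub, inv_mul_cancel₀ h4]

lemma Mg_neg_eq (a : ℝ) : Mg (-a) = 2 * Real.exp (a ^ 2 / 2) * (1 - stdGaussianCDF a) := by
  rw [Mg_eq, cdf_neg]; simp

lemma log_Mg (a : ℝ) : Real.log 2 + a ^ 2 / 2 + Real.log (stdGaussianCDF a) = Real.log (Mg a) := by
  have h := Mg_pos a
  have h' := Mg_eq a
  rw [h'] at h ⊢
  have h0 : stdGaussianCDF a ≠ 0 := by
    rintro h0; rw [h0] at h; simp at h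
  rw [Real.log_mul (by positivity) h0, Real.log_mul (by positivity) (by positivity), Real.log_exp]

lemma log_Mg_neg (a : ℝ) : Real.log 2 + a ^ 2 / 2 + Real.log (1 - stdGaussianCDF a) = Real.log (Mg (-a)) := by
  rw [← log_Mg, cdf_neg]; simp

instance gp_prob (d : ℕ) : IsProbabilityMeasure (gaussPi d) := by unfold gaussPi; infer_instance

lemma gp_map_eval {d : ℕ} (i : Fin d) : (gaussPi d).map (fun h => h i) = gaussianReal 0 1 :=
  (measurePreserving_eval (fun _ : Fin d => gaussianReal 0 1) i).map_eq

lemma gp_indep (d : ℕ) : iIndepFun (fun (i : Fin d) (h : Fin d → ℝ) => h i) (gaussPi d) :=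
  iIndepFun_pi (μ := fun _ : Fin d => gaussianReal 0 1) (X := fun _ x => x) (fun _ => aemeasurable_id)

lemma gp_mgf_abs {d : ℕ} (X : (Fin d → ℝ) → ℝ) (hX : Measurable X)
    (hl : (gaussPi d).map X = gaussianReal 0 1) (a : ℝ) :
    mgf (fun h => |X h|) (gaussPi d) a = Mg a ∧
    Integrable (fun h => Real.exp (a * |X h|)) (gaussPi d) := by
  constructor
  · unfold Mg mgf
    rw [← hl, integral_map hX.aemeasurable]
    fun_prop
  · have := Mg_int a
    rw [← hl] at this
    exact this.comp_measurable hX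

lemma gp_mgf_sum {d : ℕ} (L : Finset (Fin d)) (c : ℝ) (a : ℝ) :
    mgf (fun h => c * ∑ l ∈ L, |h l|) (gaussPi d) a = Mg (a * c) ^ L.card ∧
    Integrable (fun h => Real.exp (a * (c * ∑ l ∈ L, |h l|))) (gaussPi d) := by
  have hi : iIndepFun (fun (i : Fin d) (h : Fin d → ℝ) => |h i|) (gaussPi d) :=
    (gp_indep d).comp (fun _ x => |x|) (fun _ => by fun_prop)
  have hm : ∀ i : Fin d, Measurable (fun (h : Fin d → ℝ) => |h i|) := by intro i; fun_prop
  have h1 := hi.mgf_sum hm L (t := a * c)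
  have h2 := hi.integrable_exp_mul_sum hm (s := L) (t := a * c) (fun i _ =>
    (gp_mgf_abs (fun h => h i) (by fun_prop) (gp_map_eval i) _).2)
  constructor
  · rw [Finset.prod_congr rfl (fun i _ => 
      (gp_mgf_abs (fun h => h i) (by fun_prop) (gp_map_eval i) _).1), Finset.prod_const] at h1
    rw [← h1]
    unfold mgf
    congr 1; ext h; simp [mul_assoc]
  · refine h2.congr (Eventually.of_forall fun h => ?_)
    simp [mul_assoc]

lemma gp_row_law {d m : ℕ} (idx : Fin m → Fin d) (hidx : Function.Injective idx) (q : Fin m → ℝ)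
    (hq : ∑ j, q j ^ 2 = 1) :
    (gaussPi d).map (fun h => ∑ j, h (idx j) * q j) = gaussianReal 0 1 := by
  have hi : iIndepFun (fun (j : Fin m) (h : Fin d → ℝ) => h (idx j) * q j) (gaussPi d) :=
    ((gp_indep d).precomp hidx).comp (fun j x => x * q j) (fun _ => by fun_prop)
  have : IsProbabilityMeasure ((gaussPi d).map (fun h => ∑ j, h (idx j) * q j)) :=
    Measure.isProbabilityMeasure_map
      (Measurable.aemeasurable (by fun_prop))
  apply Measure.ext_of_charFun
  rw [hi.charFun_map_fun_sum_eq_prod (fun i => Measurable.aemeasurable (by fun_prop))]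
  ext t
  have h1 : ∀ j, (gaussPi d).map (fun h => h (idx j) * q j) = gaussianReal 0 (.mk (q j ^ 2) (sq_nonneg _)) := by
    intro j
    have := gaussianReal_map_mul_const (μ := 0) (v := 1) (q j)
    rw [← gp_map_eval (idx j), Measure.map_map (by fun_prop) (by fun_prop)] at this
    simpa [Function.comp_def] using this
  simp only [Finset.prod_apply, h1, charFun_gaussianReal]
  rw [← Complex.exp_sum]
  congr 1
  simp
  have : (∑ j, (q j : ℂ) ^ 2) = 1 := by exact_mod_cast hq
  rw [← Finset.sum_div, ← Finset.sum_mul, this, one_mul]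

lemma gp_row_mgf {d m : ℕ} (idx : Fin m → Fin d) (hidx : Function.Injective idx) (q : Fin m → ℝ)
    (hq : ∑ j, q j ^ 2 = 1) (μ ε : ℝ) (hμ : 0 ≤ μ) (hε : 0 ≤ ε) :
    mgf (fun h => -|∑ j, h (idx j) * q j| + ε * ∑ j, |h (idx j)|) (gaussPi d) μ ≤
      Mg (-μ) + Mg (μ * ε) ^ m - 1 ∧
    Integrable (fun h => Real.exp (μ * (-|∑ j, h (idx j) * q j| + ε * ∑ j, |h (idx j)|))) (gaussPi d) := by
  have hL : ∀ h : Fin d → ℝ, ∑ j, |h (idx j)| = ∑ l ∈ univ.map ⟨idx, hidx⟩, |h l| := by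
    intro h; simp
  obtain ⟨a1, a2⟩ := gp_mgf_sum (univ.map ⟨idx, hidx⟩) ε μ
  simp_rw [← hL] at a1 a2
  obtain ⟨b1, b2⟩ := gp_mgf_abs (fun h : Fin d → ℝ => ∑ j, h (idx j) * q j) (by fun_prop)
    (gp_row_law idx hidx q hq) (-μ)
  have key : ∀ h : Fin d → ℝ, Real.exp (μ * (-|∑ j, h (idx j) * q j| + ε * ∑ j, |h (idx j)|)) ≤
     Real.exp (-μ * |∑ j, h (idx j) * q j|) + Real.exp (μ * (ε * ∑ j, |h (idx j)|)) - 1 := by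
    intro h
    rw [show μ * (-|∑ j, h (idx j) * q j| + ε * ∑ j, |h (idx j)|) =
      -μ * |∑ j, h (idx j) * q j| + μ * (ε * ∑ j, |h (idx j)|) by ring, Real.exp_add]
    have e1 : Real.exp (-μ * |∑ j, h (idx j) * q j|) ≤ 1 := by
      rw [Real.exp_le_one_iff]
      have := mul_nonneg hμ (abs_nonneg (∑ j, h (idx j) * q j))
      linarith
    have e2 : 1 ≤ Real.exp (μ * (ε * ∑ j, |h (idx j)|)) := by
      rw [Real.one_le_exp_iff]
      have := Finset.sum_nonneg (fun j (_ : j ∈ univ) => abs_nonneg (h (idx j)))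
      positivity
    nlinarith
  have hint := (b2.add a2).sub (integrable_const (1 : ℝ))
  have hi2 : Integrable (fun h => Real.exp (μ * (-|∑ j, h (idx j) * q j| + ε * ∑ j, |h (idx j)|))) (gaussPi d) := by
    refine hint.mono' (by fun_prop) (Eventually.of_forall fun h => ?_)
    rw [Real.norm_of_nonneg (Real.exp_pos _).le]
    exact key h
  refine ⟨?_, hi2⟩
  have := integral_mono hi2 hint key
  simp only [Finset.card_map, Finset.card_univ, Fintype.card_fin] at a1
  unfold mgf at a1 b1 ⊢
  refine this.trans (le_of_eq ?_)
  have e := integral_sub (b2.add a2) (integrable_const (μ := gaussPi d) (1 : ℝ))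
  have e' := integral_add b2 a2
  simp only [Pi.add_apply] at e ⊢
  simp only [Pi.sub_apply, Pi.add_apply]
  rw [e, e', a1, b1]
  simp

def Dep {d : ℕ} (S : Finset (Fin d)) (V : (Fin d → ℝ) → ℝ) : Prop :=
  ∃ g : (S → ℝ) → ℝ, Measurable g ∧ V = fun h => g (fun l => h l)

lemma Dep.meas {d : ℕ} {S : Finset (Fin d)} {V : (Fin d → ℝ) → ℝ} (h : Dep S V) : Measurable V := by
  obtain ⟨g, hg, rfl⟩ := h
  exact hg.comp (by fun_prop)

lemma Dep.mono {d : ℕ} {S T : Finset (Fin d)} {V : (Fin d → ℝ) → ℝ} (h : Dep S V) (hST : S ⊆ T) :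
    Dep T V := by
  obtain ⟨g, hg, rfl⟩ := h
  exact ⟨fun x => g (fun l => x ⟨l.1, hST l.2⟩), hg.comp (by fun_prop), rfl⟩

lemma Dep.add {d : ℕ} {S : Finset (Fin d)} {V W : (Fin d → ℝ) → ℝ} (h : Dep S V) (h' : Dep S W) :
    Dep S (V + W) := by
  obtain ⟨g, hg, rfl⟩ := h
  obtain ⟨g', hg', rfl⟩ := h'
  exact ⟨fun x => g x + g' x, hg.add hg', rfl⟩

lemma Dep.indep {d : ℕ} {S T : Finset (Fin d)} {V W : (Fin d → ℝ) → ℝ} (h : Dep S V) (h' : Dep T W)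
    (hST : Disjoint S T) : IndepFun V W (gaussPi d) := by
  obtain ⟨g, hg, rfl⟩ := h
  obtain ⟨g', hg', rfl⟩ := h'
  exact ((gp_indep d).indepFun_finset S T hST (fun i => by fun_prop)).comp hg hg'

lemma block_mgf {d : ℕ} {ι : Type} [DecidableEq ι] (blk : ι → Finset (Fin d))
    (V : ι → (Fin d → ℝ) → ℝ) (hV : ∀ i, Dep (blk i) (V i)) (t : ℝ)
    (hint : ∀ i, Integrable (fun h => Real.exp (t * V i h)) (gaussPi d)) (I : Finset ι)
    (hI : ∀ i ∈ I, ∀ j ∈ I, i ≠ j → Disjoint (blk i) (blk j)) :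
    Dep (I.biUnion blk) (∑ i ∈ I, V i) ∧
    mgf (∑ i ∈ I, V i) (gaussPi d) t = ∏ i ∈ I, mgf (V i) (gaussPi d) t ∧
    Integrable (fun h => Real.exp (t * (∑ i ∈ I, V i) h)) (gaussPi d) := by
  induction I using Finset.induction_on with
  | empty =>
    refine ⟨⟨fun _ => 0, by fun_prop, by ext; simp⟩, by simp, by simp⟩
  | insert a s ha ih =>
    obtain ⟨h1, h2, h3⟩ := ih (fun i hi j hj => hI i (mem_insert_of_mem hi) j (mem_insert_of_mem hj))
    have hdis : Disjoint (blk a) (s.biUnion blk) := by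
      rw [Finset.disjoint_biUnion_right]
      intro j hj
      exact hI a (mem_insert_self _ _) j (mem_insert_of_mem hj) (by rintro rfl; exact ha hj)
    have hind := (hV a).indep h1 hdis
    rw [Finset.sum_insert ha, Finset.prod_insert ha, Finset.biUnion_insert]
    refine ⟨((hV a).mono subset_union_left).add (h1.mono subset_union_right), ?_, ?_⟩
    · rw [hind.mgf_add' (hV a).meas.aestronglyMeasurable h1.meas.aestronglyMeasurable, h2]
    · exact hind.integrable_exp_mul_add (hint a) h3

def ix {n m : ℕ} (i : Fin n) (j : Fin m) : Fin (n + m - 1) :=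
  ⟨i.1 + j.1, by have := i.2; have := j.2; omega⟩

lemma ix_inj {n m : ℕ} (i : Fin n) : Function.Injective (ix (m := m) i) := by
  intro j j' h
  simp only [ix, Fin.mk.injEq] at h
  ext; omega

def rowBlk (n m : ℕ) (i : Fin n) : Finset (Fin (n + m - 1)) := univ.image (ix (m := m) i)

def LK {n : ℕ} (m : ℕ) (K : Finset (Fin n)) : Finset (Fin (n + m - 1)) := K.biUnion (rowBlk n m)

lemma LK_card {n m : ℕ} (K : Finset (Fin n)) : (LK m K).card ≤ m * K.card := by
  rw [mul_comm]
  refine Finset.card_biUnion_le_card_mul _ _ _ (fun i _ => ?_)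
  exact Finset.card_image_le.trans (by simp)

def Far (m : ℕ) {n : ℕ} (i j : Fin n) : Prop := i.1 + m ≤ j.1 ∨ j.1 + m ≤ i.1

lemma Far.disj {n m : ℕ} {i j : Fin n} (h : Far m i j) : Disjoint (rowBlk n m i) (rowBlk n m j) := by
  rw [Finset.disjoint_left]
  intro l hl hl'
  simp only [rowBlk, mem_image, mem_univ, true_and] at hl hl'
  obtain ⟨a, rfl⟩ := hl
  obtain ⟨b, hb⟩ := hl'
  simp only [ix, Fin.mk.injEq] at hb
  have := a.2
  have := b.2
  rcases h with h | h <;> omega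

lemma near_card {n m : ℕ} (hm : 1 ≤ m) (i : Fin n) (R : Finset (Fin n)) [DecidablePred fun j => ¬ Far m i j] :
    (R.filter (fun j => ¬ Far m i j)).card ≤ 2 * m - 1 := by
  have : ((R.filter (fun j => ¬ Far m i j)).map Fin.valEmbedding) ⊆ Finset.Ico (i.1 + 1 - m) (i.1 + m) := by
    intro x hx
    obtain ⟨j, hj, rfl⟩ := Finset.mem_map.1 hx
    have hj := (Finset.mem_filter.1 hj).2
    unfold Far at hj
    simp only [Fin.valEmbedding_apply, Finset.mem_Ico]
    omega
  have := Finset.card_le_card this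
  rw [Finset.card_map, Nat.card_Ico] at this
  omega

open Classical in
lemma far_card {n m : ℕ} (hm : 1 ≤ m) (i : Fin n) (R : Finset (Fin n)) :
    R.card ≤ (R.filter (fun j => Far m i j)).card + (2 * m - 1) := by
  have h := Finset.card_filter_add_card_filter_not (s := R) (fun j => Far m i j)
  have := near_card hm i R
  omega

lemma remove_K {n m : ℕ} (hm : 1 ≤ m) (K : Finset (Fin n)) : ∃ R : Finset (Fin n),
    n ≤ R.card + K.card * (2 * m - 1) ∧ ∀ i ∈ K, ∀ j ∈ R, Far m i j := by
  classical
  induction K using Finset.induction_on with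
  | empty => exact ⟨univ, by simp, by simp⟩
  | insert a s ha ih =>
    obtain ⟨R, h1, h2⟩ := ih
    refine ⟨R.filter (fun j => Far m a j), ?_, ?_⟩
    · have := far_card hm a R
      rw [Finset.card_insert_of_notMem ha, add_mul]
      omega
    · intro i hi j hj
      rw [Finset.mem_filter] at hj
      rcases Finset.mem_insert.1 hi with rfl | hi
      · exact hj.2
      · exact h2 i hi j hj.1

lemma greedy {n m : ℕ} (hm : 1 ≤ m) (p : ℕ) : ∀ R : Finset (Fin n),
    p * (2 * m - 1) < R.card + (2 * m - 1) → ∃ I ⊆ R, I.card = p ∧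
      ∀ i ∈ I, ∀ j ∈ I, i ≠ j → Far m i j := by
  classical
  induction p with
  | zero => intro R _; exact ⟨∅, by simp, by simp, by simp⟩
  | succ p ih =>
    intro R hR
    rw [add_mul, one_mul] at hR
    have hR' : R.Nonempty := by
      rw [← Finset.card_pos]; omega
    obtain ⟨a, ha⟩ := hR'
    have hf := far_card hm a R
    obtain ⟨I, hI, hc, hp⟩ := ih (R.filter (fun j => Far m a j)) (by omega)
    have hIa : ∀ j ∈ I, Far m a j := fun j hj => (Finset.mem_filter.1 (hI hj)).2
    have hna : a ∉ I := by
      intro h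
      have := hIa a h
      unfold Far at this; omega
    refine ⟨insert a I, ?_, ?_, ?_⟩
    · rw [Finset.insert_subset_iff]
      exact ⟨ha, hI.trans (Finset.filter_subset _ _)⟩
    · rw [Finset.card_insert_of_notMem hna, hc]
    · intro i hi j hj hij
      rcases Finset.mem_insert.1 hi with hi1 | hi1 <;>
        rcases Finset.mem_insert.1 hj with hj1 | hj1
      · exact absurd (hi1.trans hj1.symm) hij
      · rw [hi1]; exact hIa j hj1
      · rw [hj1]; exact (hIa i hi1).symm
      · exact hp i hi1 j hj1 hij

lemma exists_I {n m : ℕ} (hm : 1 ≤ m) (K : Finset (Fin n)) (p : ℕ)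
    (hp : (p + K.card) * (2 * m - 1) < n + (2 * m - 1)) : ∃ I : Finset (Fin n), I.card = p ∧
      (∀ i ∈ I, ∀ j ∈ I, i ≠ j → Far m i j) ∧ ∀ i ∈ K, ∀ j ∈ I, Far m i j := by
  obtain ⟨R, h1, h2⟩ := remove_K hm K
  rw [add_mul] at hp
  obtain ⟨I, a, b, c⟩ := greedy hm p R (by omega)
  exact ⟨I, b, c, fun i hi j hj => h2 i hi j (a hj)⟩

/-- the Chernoff exponent variable -/
def W {n m : ℕ} (ε : ℝ) (K I : Finset (Fin n)) (q : Fin m → ℝ) (h : Fin (n + m - 1) → ℝ) : ℝ :=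
  Real.sqrt m * ∑ l ∈ LK m K, |h l| +
    ∑ i ∈ I, (-|∑ j, h (ix i j) * q j| + ε * ∑ j, |h (ix i j)|)

lemma W_bound {n m : ℕ} (ε μ : ℝ) (hε : 0 ≤ ε) (hμ : 0 ≤ μ) (K I : Finset (Fin n)) (q : Fin m → ℝ)
    (hq : ∑ j, q j ^ 2 = 1) (hI : ∀ i ∈ I, ∀ j ∈ I, i ≠ j → Far m i j)
    (hKI : ∀ i ∈ K, ∀ j ∈ I, Far m i j) :
    (gaussPi (n + m - 1)).real {h | 0 ≤ W ε K I q h} ≤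
      Mg (μ * Real.sqrt m) ^ (m * K.card) * (Mg (-μ) + Mg (μ * ε) ^ m - 1) ^ I.card := by
  classical
  have hrow := fun i : Fin n => gp_row_mgf (ix (m := m) i) (ix_inj i) q hq μ ε hμ hε
  set V : Fin n → (Fin (n + m - 1) → ℝ) → ℝ := fun i h =>
    (-|∑ j, h (ix i j) * q j| + ε * ∑ j, |h (ix i j)|) with hVdef
  have hV : ∀ i, Dep (rowBlk n m i) (V i) := by
    intro i
    have hmem : ∀ j, ix (m := m) i j ∈ rowBlk n m i := fun j => by simp [rowBlk]
    exact ⟨fun x => (-|∑ j, x ⟨ix i j, hmem j⟩ * q j| + ε * ∑ j, |x ⟨ix i j, hmem j⟩|),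
      by fun_prop, rfl⟩
  obtain ⟨h1, h2, h3⟩ := block_mgf (rowBlk n m) V hV μ (fun i => (hrow i).2) I
    (fun i hi j hj hij => (hI i hi j hj hij).disj)
  obtain ⟨s1, s2⟩ := gp_mgf_sum (LK m K) (Real.sqrt m) μ
  have hS : Dep (LK m K) (fun h => Real.sqrt m * ∑ l ∈ LK m K, |h l|) := by
    refine ⟨fun x => Real.sqrt m * ∑ l, |x l|, by fun_prop, ?_⟩
    ext h
    rw [← Finset.sum_coe_sort]
  have hdis : Disjoint (LK m K) (I.biUnion (rowBlk n m)) := by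
    unfold LK
    rw [Finset.disjoint_biUnion_left]
    intro i hi
    rw [Finset.disjoint_biUnion_right]
    intro j hj
    exact (hKI i hi j hj).disj
  have hind := hS.indep h1 hdis
  have hWe : W ε K I q = (fun h => Real.sqrt m * ∑ l ∈ LK m K, |h l|) + ∑ i ∈ I, V i := by
    ext h
    simp [W, hVdef]
  have hWint : Integrable (fun h => Real.exp (μ * W ε K I q h)) (gaussPi (n + m - 1)) := by
    rw [hWe]
    exact hind.integrable_exp_mul_add s2 h3
  have := measure_ge_le_exp_mul_mgf (X := W ε K I q) 0 hμ hWint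
  refine this.trans ?_
  rw [hWe, hind.mgf_add' hS.meas.aestronglyMeasurable h1.meas.aestronglyMeasurable, s1, h2]
  simp only [mul_zero, Real.exp_zero, one_mul]
  have hM1 : 1 ≤ Mg (μ * Real.sqrt m) := by
    rw [← Mg_zero]; exact Mg_mono (by positivity)
  apply mul_le_mul
  · exact pow_le_pow_right₀ hM1 (LK_card K)
  · rw [← Finset.prod_const]
    exact Finset.prod_le_prod (fun i _ => mgf_nonneg) (fun i _ => (hrow i).1)
  · exact Finset.prod_nonneg (fun i _ => mgf_nonneg)
  · exact pow_nonneg (Mg_pos _).le _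

lemma W_meas {n m : ℕ} (ε : ℝ) (K I : Finset (Fin n)) (q : Fin m → ℝ) :
    Measurable (W ε K I q) := by
  unfold W; fun_prop

lemma det1 {n m : ℕ} (K : Finset (Fin n)) (u : Fin m → ℝ) (hu : ∑ j, u j ^ 2 = 1)
    (h : Fin (n + m - 1) → ℝ) :
    ∑ i ∈ K, |∑ j, h (ix i j) * u j| ≤ Real.sqrt m * ∑ l ∈ LK m K, |h l| := by
  have h1 : ∑ i ∈ K, |∑ j, h (ix i j) * u j| ≤ ∑ j, |u j| * ∑ l ∈ LK m K, |h l| := by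
    calc ∑ i ∈ K, |∑ j, h (ix i j) * u j| ≤ ∑ i ∈ K, ∑ j, |h (ix i j)| * |u j| := by
          refine Finset.sum_le_sum fun i _ => ?_
          refine (Finset.abs_sum_le_sum_abs _ _).trans (le_of_eq ?_)
          exact Finset.sum_congr rfl fun j _ => abs_mul _ _
      _ = ∑ j, |u j| * ∑ i ∈ K, |h (ix i j)| := by
          rw [Finset.sum_comm]
          refine Finset.sum_congr rfl fun j _ => ?_
          rw [Finset.mul_sum]
          exact Finset.sum_congr rfl fun i _ => mul_comm _ _
      _ ≤ _ := by
          refine Finset.sum_le_sum fun j _ => ?_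
          refine mul_le_mul_of_nonneg_left ?_ (abs_nonneg _)
          have hinj : ∀ i ∈ K, ∀ i' ∈ K, ix i j = ix i' j → i = i' := by
            intro i _ i' _ hh
            simp only [ix, Fin.mk.injEq] at hh
            ext; omega
          have : ∑ i ∈ K, |h (ix i j)| = ∑ l ∈ K.image (fun i => ix i j), |h l| := by
            rw [Finset.sum_image hinj]
          rw [this]
          refine Finset.sum_le_sum_of_subset_of_nonneg ?_ (fun _ _ _ => abs_nonneg _)
          intro l hl
          obtain ⟨i, hi, rfl⟩ := Finset.mem_image.1 hl
          exact Finset.mem_biUnion.2 ⟨i, hi, by simp [rowBlk]⟩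
  refine h1.trans ?_
  rw [← Finset.sum_mul]
  refine mul_le_mul_of_nonneg_right ?_ (Finset.sum_nonneg fun _ _ => abs_nonneg _)
  apply Real.le_sqrt_of_sq_le
  have := sq_sum_le_card_mul_sum_sq (s := (univ : Finset (Fin m))) (f := fun j => |u j|)
  simpa [hu] using this

lemma det2 {n m : ℕ} (ε : ℝ) (I : Finset (Fin n)) (u q : Fin m → ℝ) (huq : ∀ j, |u j - q j| ≤ ε)
    (h : Fin (n + m - 1) → ℝ) :
    - ∑ i ∈ I, |∑ j, h (ix i j) * u j| ≤
      ∑ i ∈ I, (-|∑ j, h (ix i j) * q j| + ε * ∑ j, |h (ix i j)|) := by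
  rw [← Finset.sum_neg_distrib]
  refine Finset.sum_le_sum fun i _ => ?_
  have h1 : |∑ j, h (ix i j) * q j| ≤ |∑ j, h (ix i j) * u j| + |∑ j, h (ix i j) * (u j - q j)| := by
    have : ∑ j, h (ix i j) * q j = ∑ j, h (ix i j) * u j - ∑ j, h (ix i j) * (u j - q j) := by
      rw [← Finset.sum_sub_distrib]
      exact Finset.sum_congr rfl fun j _ => by ring
    rw [this]
    exact abs_sub _ _
  have h2 : |∑ j, h (ix i j) * (u j - q j)| ≤ ε * ∑ j, |h (ix i j)| := by
    refine (Finset.abs_sum_le_sum_abs _ _).trans ?_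
    rw [Finset.mul_sum]
    refine Finset.sum_le_sum fun j _ => ?_
    rw [abs_mul, mul_comm]
    exact mul_le_mul_of_nonneg_right (huq j) (abs_nonneg _)
  linarith

lemma det3 {n m : ℕ} (hm : 1 ≤ m) (ε : ℝ) (Q : Set (Fin m → ℝ))
    (hQ : ∀ u : Fin m → ℝ, ∑ j, u j ^ 2 = 1 → ∃ q ∈ Q, ∀ j, |u j - q j| ≤ ε)
    (K I : Finset (Fin n)) (hKI : ∀ i ∈ K, ∀ j ∈ I, Far m i j)
    (h : Fin (n + m - 1) → ℝ) (hW : ∀ q ∈ Q, W ε K I q h < 0) (z : Fin m → ℝ) (hz : z ≠ 0) :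
    ∑ i ∈ K, |∑ j, h (ix i j) * z j| < ∑ i ∈ Kᶜ, |∑ j, h (ix i j) * z j| := by
  classical
  have hpos : 0 < ∑ j, z j ^ 2 := by
    obtain ⟨j, hj⟩ := Function.ne_iff.1 hz
    exact Finset.sum_pos' (fun _ _ => sq_nonneg _) ⟨j, mem_univ _, by simpa using (sq_pos_of_ne_zero hj)⟩
  set r := Real.sqrt (∑ j, z j ^ 2) with hr
  have hr0 : 0 < r := Real.sqrt_pos.2 hpos
  have hr2 : r ^ 2 = ∑ j, z j ^ 2 := Real.sq_sqrt hpos.le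
  set u : Fin m → ℝ := fun j => z j / r with hu
  have hu1 : ∑ j, u j ^ 2 = 1 := by
    simp only [hu, div_pow]
    rw [← Finset.sum_div, ← hr2, div_self (by positivity)]
  obtain ⟨q, hq, hqu⟩ := hQ u hu1
  have a1 := det1 K u hu1 h
  have a2 := det2 ε I u q hqu h
  have a3 := hW q hq
  unfold W at a3
  have hsub : I ⊆ Kᶜ := by
    intro i hi
    rw [Finset.mem_compl]
    intro hk
    have := hKI i hk i hi
    unfold Far at this; omega
  have a4 : ∑ i ∈ I, |∑ j, h (ix i j) * u j| ≤ ∑ i ∈ Kᶜ, |∑ j, h (ix i j) * u j| :=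
    Finset.sum_le_sum_of_subset_of_nonneg hsub (fun _ _ _ => abs_nonneg _)
  have a5 : ∑ i ∈ K, |∑ j, h (ix i j) * u j| < ∑ i ∈ Kᶜ, |∑ j, h (ix i j) * u j| := by linarith
  have hzu : ∀ i : Fin n, |∑ j, h (ix i j) * z j| = r * |∑ j, h (ix i j) * u j| := by
    intro i
    rw [← abs_of_pos hr0, ← abs_mul, Finset.mul_sum]
    congr 1
    refine Finset.sum_congr rfl fun j _ => ?_
    simp only [hu]; field_simp
  simp_rw [hzu]
  rw [← Finset.mul_sum, ← Finset.mul_sum]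
  exact mul_lt_mul_of_pos_left a5 hr0

lemma det4 {n : ℕ} (K : Finset (Fin n)) (e w : Fin n → ℝ) (he : ∀ i, e i ≠ 0 → i ∈ K)
    (hw : ∑ i ∈ K, |w i| < ∑ i ∈ Kᶜ, |w i|) : l1 e < l1 (e - w) := by
  unfold l1
  rw [← Finset.sum_add_sum_compl K, ← Finset.sum_add_sum_compl K (fun i => |(e - w) i|)]
  have h1 : ∑ i ∈ Kᶜ, |e i| = 0 := by
    refine Finset.sum_eq_zero fun i hi => ?_
    rw [Finset.mem_compl] at hi
    by_contra hc
    exact hi (he i (by simpa using hc))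
  have h2 : ∑ i ∈ Kᶜ, |(e - w) i| = ∑ i ∈ Kᶜ, |w i| := by
    refine Finset.sum_congr rfl fun i hi => ?_
    rw [Finset.mem_compl] at hi
    have : e i = 0 := by
      by_contra hc
      exact hi (he i hc)
    simp [this]
  have h3 : ∑ i ∈ K, |e i| ≤ ∑ i ∈ K, |(e - w) i| + ∑ i ∈ K, |w i| := by
    rw [← Finset.sum_add_distrib]
    refine Finset.sum_le_sum fun i _ => ?_
    have := abs_add_le ((e - w) i) (w i)
    simpa using this
  linarith

lemma good {n m : ℕ} (hm : 1 ≤ m) (β : ℝ) (ε : ℝ) (Q : Set (Fin m → ℝ)) (k : ℕ) (hk : ∀ s : ℕ, (s : ℝ) ≤ β * n → s ≤ k) (hkn : k ≤ n)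
    (hQ : ∀ u : Fin m → ℝ, ∑ j, u j ^ 2 = 1 → ∃ q ∈ Q, ∀ j, |u j - q j| ≤ ε)
    (I : Finset (Fin n) → Finset (Fin n))
    (hKI : ∀ K : Finset (Fin n), K.card = k → ∀ i ∈ K, ∀ j ∈ I K, Far m i j)
    (h : Fin (n + m - 1) → ℝ)
    (hW : ∀ K : Finset (Fin n), K.card = k → ∀ q ∈ Q, W ε K (I K) q h < 0) :
    ∀ x : Fin m → ℝ, ∀ e : Fin n → ℝ, (sparsity e : ℝ) ≤ β * n →
            ∀ z : Fin m → ℝ, z ≠ x →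
              l1 ((toeplitz n m h).mulVec x + e - (toeplitz n m h).mulVec x) <
              l1 ((toeplitz n m h).mulVec x + e - (toeplitz n m h).mulVec z) := by
  classical
  intro x e hs z hzx
  obtain ⟨K, hKs, -, hKc⟩ := Finset.exists_subsuperset_card_eq
    (s := univ.filter fun i => e i ≠ 0) (t := univ) (n := k) (Finset.subset_univ _)
    (by have := hk _ hs; unfold sparsity at this; convert this) (by simpa using hkn)
  have := det3 hm ε Q hQ K (I K) (hKI K hKc) h (hW K hKc) (z - x) (sub_ne_zero.2 hzx)
  have h4 := det4 K e (fun i => ∑ j, h (ix i j) * (z - x) j) (fun i hi => hKs (by simpa using hi)) this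
  have e1 : (toeplitz n m h).mulVec x + e - (toeplitz n m h).mulVec x = e := by abel
  have e2 : (toeplitz n m h).mulVec x + e - (toeplitz n m h).mulVec z =
      e - (fun i => ∑ j, h (ix i j) * (z - x) j) := by
    have : (fun i => ∑ j, h (ix i j) * (z - x) j) = (toeplitz n m h).mulVec (z - x) := by
      ext i; rfl
    rw [this, Matrix.mulVec_sub]; abel
  rw [e1, e2]
  exact h4

lemma net (m : ℕ) (ε : ℝ) (hε : 0 < ε) : ∃ Q : Finset (Fin m → ℝ), (∀ q ∈ Q, ∑ j, q j ^ 2 = 1) ∧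
    ∀ u : Fin m → ℝ, ∑ j, u j ^ 2 = 1 → ∃ q ∈ Q, ∀ j, |u j - q j| ≤ ε := by
  have hc : IsCompact {u : Fin m → ℝ | ∑ j, u j ^ 2 = 1} := by
    apply Metric.isCompact_of_isClosed_isBounded
    · exact isClosed_eq (by fun_prop) (by fun_prop)
    · refine (Metric.isBounded_closedBall (x := 0) (r := 1)).subset ?_
      intro u hu
      rw [mem_closedBall_zero_iff, pi_norm_le_iff_of_nonneg zero_le_one]
      intro j
      have : u j ^ 2 ≤ 1 := by
        rw [← (show ∑ j, u j ^ 2 = 1 from hu)]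
        exact Finset.single_le_sum (f := fun j => u j ^ 2) (fun _ _ => sq_nonneg _) (mem_univ j)
      rw [Real.norm_eq_abs]
      exact (sq_le_one_iff_abs_le_one _).1 this
  obtain ⟨t, ht, htf, hcov⟩ := finite_cover_balls_of_compact hc hε
  refine ⟨htf.toFinset, fun q hq => ht (by simpa using hq), fun u hu => ?_⟩
  obtain ⟨q, hq, hb⟩ := Set.mem_iUnion₂.1 (hcov hu)
  refine ⟨q, by simpa using hq, fun j => ?_⟩
  rw [← Real.dist_eq]
  exact (dist_le_pi_dist u q j).trans (Metric.mem_ball.1 hb).le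

lemma choose_bound (β : ℝ) (hβ0 : 0 < β) (hβ1 : β < 1) (n k : ℕ) (hk : k ≤ n) :
    (n.choose k : ℝ) ≤ Real.exp (k * Real.log (1 / β) + ((n : ℝ) - k) * Real.log (1 / (1 - β))) := by
  have h1 : 0 < 1 - β := by linarith
  have h2 : β ^ k * (1 - β) ^ (n - k) * (n.choose k : ℝ) ≤ 1 := by
    have h := add_pow β (1 - β) n
    rw [show β + (1 - β) = 1 by ring, one_pow] at h
    refine le_trans ?_ h.ge
    exact Finset.single_le_sum (f := fun k => β ^ k * (1 - β) ^ (n - k) * (n.choose k : ℝ))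
      (fun i _ => by positivity) (show k ∈ Finset.range (n + 1) from Finset.mem_range.2 (by omega))
  have h3 : Real.exp (k * Real.log (1 / β) + ((n : ℝ) - k) * Real.log (1 / (1 - β))) =
      (β ^ k * (1 - β) ^ (n - k))⁻¹ := by
    rw [← Nat.cast_sub hk, Real.exp_add, Real.exp_nat_mul, Real.exp_nat_mul,
      Real.exp_log (by positivity), Real.exp_log (by positivity)]
    simp [mul_comm]
  rw [h3, ← one_div, le_div_iff₀ (by positivity)]
  linarith

lemma pow_eq_exp {A : ℝ} (hA : 0 < A) (k : ℕ) : A ^ k = Real.exp (k * Real.log A) := by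
  rw [Real.exp_nat_mul, Real.exp_log hA]

set_option maxHeartbeats 2000000 in
/-- For a fixed `m ≥ 1`, any `β ∈ (0,1)` satisfying the stated
transcendental condition (for some `μ > 0` and `0 < δ < 1`) is such that, with
probability at least `1 - e^{-c₁ n}` for large `n ≥ m`, the Gaussian Toeplitz matrix
corrects every pattern of at most `β n` outliers: every `x` is the unique
ℓ¹ minimizer. -/
theorem stmt0 (m : ℕ) (hm : 1 ≤ m) (β : ℝ) (hβ0 : 0 < β) (hβ1 : β < 1)
    (hcond : ∃ μ : ℝ, 0 < μ ∧ ∃ δ : ℝ, 0 < δ ∧ δ < 1 ∧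
      β * Real.log (1 / β) + (1 - β) * Real.log (1 / (1 - β))
        + (m : ℝ) * β *
          (Real.log 2 + (m : ℝ) * μ ^ 2 / 2
            + Real.log (stdGaussianCDF (μ * Real.sqrt (m : ℝ))))
        + (1 / (2 * (m : ℝ) - 1) - β) *
          (Real.log 2 + μ ^ 2 * (1 - δ) ^ 2 / 2
            + Real.log (1 - stdGaussianCDF (μ * (1 - δ)))) < 0) :
    ∃ c₁ : ℝ, 0 < c₁ ∧ ∃ N : ℕ, ∀ n : ℕ, N ≤ n → m ≤ n →
      ENNReal.ofReal (1 - Real.exp (-c₁ * n)) ≤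
        gaussPi (n + m - 1)
          {h | ∀ x : Fin m → ℝ, ∀ e : Fin n → ℝ, (sparsity e : ℝ) ≤ β * n →
            ∀ z : Fin m → ℝ, z ≠ x →
              l1 ((toeplitz n m h).mulVec x + e - (toeplitz n m h).mulVec x) <
              l1 ((toeplitz n m h).mulVec x + e - (toeplitz n m h).mulVec z)} := by
  obtain ⟨μ, hμ, δ, hδ0, hδ1, hc⟩ := hcond
  have hm1 : (1 : ℝ) ≤ m := by exact_mod_cast hm
  have hA : Real.log 2 + (m : ℝ) * μ ^ 2 / 2
            + Real.log (stdGaussianCDF (μ * Real.sqrt (m : ℝ))) = Real.log (Mg (μ * Real.sqrt m)) := by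
    rw [← log_Mg, mul_pow, Real.sq_sqrt (by positivity)]; ring_nf
  have hB : Real.log 2 + μ ^ 2 * (1 - δ) ^ 2 / 2
            + Real.log (1 - stdGaussianCDF (μ * (1 - δ))) = Real.log (Mg (-(μ * (1 - δ)))) := by
    rw [← log_Mg_neg, mul_pow]
  rw [hA, hB] at hc
  have hA1 : 1 ≤ Mg (μ * Real.sqrt m) := by
    rw [← Mg_zero]; exact Mg_mono (by positivity)
  have hB1 : Mg (-(μ * (1 - δ))) ≤ 1 := by
    exact (Mg_mono (show -(μ * (1 - δ)) ≤ 0 by nlinarith)).trans_eq Mg_zero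
  have hB0 : Mg (-μ) ≤ Mg (-(μ * (1 - δ))) := Mg_mono (by nlinarith)
  have hBp := Mg_pos (-(μ * (1 - δ)))
  set A := Mg (μ * Real.sqrt m) with hAdef
  set B := Mg (-(μ * (1 - δ))) with hBdef
  have hLA : 0 ≤ Real.log A := Real.log_nonneg hA1
  have hLB : Real.log B ≤ 0 := Real.log_nonpos hBp.le hB1
  have hb1 : 0 < 1 - β := by linarith
  have hl1 : 0 < Real.log (1 / β) := Real.log_pos (by rw [lt_div_iff₀ hβ0]; linarith)
  have hl2 : 0 < Real.log (1 / (1 - β)) := Real.log_pos (by rw [lt_div_iff₀ hb1]; linarith)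
  set y1 := Real.log (1 / β)
  set y2 := Real.log (1 / (1 - β))
  have hDpos : (0 : ℝ) < 2 * m - 1 := by linarith
  have hD : 0 < 1 / (2 * (m : ℝ) - 1) - β := by
    by_contra hcon
    push Not at hcon
    have e1 := mul_nonneg_of_nonpos_of_nonpos hcon hLB
    have e2 : 0 ≤ β * y1 := by positivity
    have e3 : 0 ≤ (1 - β) * y2 := by positivity
    have e4 : 0 ≤ m * β * Real.log A := by positivity
    linarith
  set D := 1 / (2 * (m : ℝ) - 1) with hDdef
  have hD1 : D * (2 * m - 1) = 1 := by rw [hDdef]; field_simp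
  obtain ⟨t, ht0, htc⟩ : ∃ t : ℝ, 0 < t ∧ β * y1 + (1 - β) * y2 + m * β * Real.log A +
      (D - β) * Real.log (B + t) < 0 := by
    have hcont : ContinuousAt (fun t : ℝ => β * y1 + (1 - β) * y2 + m * β * Real.log A +
      (D - β) * Real.log (B + t)) 0 := by
      have : ContinuousAt (fun t : ℝ => Real.log (B + t)) 0 :=
        ContinuousAt.log (by fun_prop) (by simpa using hBp.ne')
      fun_prop
    have := hcont.eventually_lt_const (u := 0) (by simpa using hc)
    obtain ⟨r, hr, hball⟩ := Metric.eventually_nhds_iff.1 this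
    refine ⟨r / 2, by positivity, hball ?_⟩
    rw [Real.dist_eq, sub_zero, abs_of_pos (by positivity)]; linarith
  obtain ⟨ε, hε0, hεt⟩ : ∃ ε : ℝ, 0 < ε ∧ Mg (μ * ε) ^ m < 1 + t := by
    have hcont : ContinuousAt (fun ε : ℝ => Mg (μ * ε) ^ m) 0 := by
      have : Continuous (fun ε : ℝ => Mg (μ * ε) ^ m) := (Mg_cont.comp (by fun_prop)).pow m
      exact this.continuousAt
    have := hcont.eventually_lt_const (u := 1 + t) (by simpa [Mg_zero] using ht0)
    obtain ⟨r, hr, hball⟩ := Metric.eventually_nhds_iff.1 this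
    refine ⟨r / 2, by positivity, hball ?_⟩
    rw [Real.dist_eq, sub_zero, abs_of_pos (by positivity)]; linarith
  have hE1 : 1 ≤ Mg (μ * ε) ^ m := by
    apply one_le_pow₀
    rw [← Mg_zero]; exact Mg_mono (by positivity)
  obtain ⟨Q, hQ1, hQ2⟩ := net m ε hε0
  set y := Real.log (B + t) with hy
  set F := β * y1 + (1 - β) * y2 + m * β * Real.log A + (D - β) * y with hF
  set C : ℝ := Q.card * Real.exp (y2 + 2 * |y|) with hC
  refine ⟨-F / 2, by linarith, ⌈C / (-F / 2)⌉₊, fun n hn hmn => ?_⟩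
  have hCn : C ≤ Real.exp (-F / 2 * n) := by
    have h1 : C / (-F / 2) ≤ n := Nat.ceil_le.1 hn
    rw [div_le_iff₀ (by linarith)] at h1
    have := Real.add_one_le_exp (-F / 2 * n)
    linarith
  have hn0 : (0 : ℝ) ≤ n := by positivity
  set k := ⌊β * n⌋₊ with hk
  have hk1 : (k : ℝ) ≤ β * n := Nat.floor_le (by positivity)
  have hk2 : β * n < k + 1 := Nat.lt_floor_add_one _
  have hkn : k ≤ n := by
    have : (k : ℝ) ≤ n := by nlinarith
    exact_mod_cast this
  have hpk : (0 : ℝ) ≤ n * D - k := by nlinarith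
  set p := ⌈n * D - k⌉₊ with hp
  have hp1 : n * D - k ≤ p := Nat.le_ceil _
  have hp2 : (p : ℝ) < n * D - k + 1 := Nat.ceil_lt_add_one hpk
  have hpc : (p + k) * (2 * m - 1) < n + (2 * m - 1) := by
    have h2m : ((2 * m - 1 : ℕ) : ℝ) = 2 * m - 1 := by
      rw [Nat.cast_sub (by omega)]; push_cast; ring
    have : (((p + k) * (2 * m - 1) : ℕ) : ℝ) < ((n + (2 * m - 1) : ℕ) : ℝ) := by
      push_cast
      rw [h2m]
      have h3 : (p : ℝ) + k < n * D + 1 := by linarith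
      have h4 := mul_lt_mul_of_pos_right h3 hDpos
      have h5 : (n * D + 1) * (2 * (m : ℝ) - 1) = n * (D * (2 * m - 1)) + (2 * m - 1) := by ring
      rw [hD1] at h5
      linarith
    exact_mod_cast this
  have hex : ∀ K : Finset (Fin n), ∃ I : Finset (Fin n), K.card = k → I.card = p ∧
      (∀ i ∈ I, ∀ j ∈ I, i ≠ j → Far m i j) ∧ ∀ i ∈ K, ∀ j ∈ I, Far m i j := by
    intro K
    by_cases hK : K.card = k
    · obtain ⟨I, hI⟩ := exists_I hm K p (by rw [hK]; exact hpc)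
      exact ⟨I, fun _ => hI⟩
    · exact ⟨∅, fun h => absurd h hK⟩
  choose I hI using hex
  set bad : Set (Fin (n + m - 1) → ℝ) := ⋃ K ∈ Finset.powersetCard k (univ : Finset (Fin n)),
    ⋃ q ∈ Q, {h | 0 ≤ W ε K (I K) q h} with hbad
  have hbm : MeasurableSet bad := by
    refine Finset.measurableSet_biUnion _ fun K _ => Finset.measurableSet_biUnion _ fun q _ => ?_
    exact measurableSet_le measurable_const (W_meas _ _ _ _)
  have hbound : (gaussPi (n + m - 1)).real bad ≤ Real.exp (F / 2 * n) := by
    have s1 : (gaussPi (n + m - 1)).real bad ≤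
        ∑ K ∈ Finset.powersetCard k (univ : Finset (Fin n)), ∑ q ∈ Q, A ^ (m * k) * (B + t) ^ p := by
      refine (measureReal_biUnion_finset_le _ _).trans (Finset.sum_le_sum fun K hK => ?_)
      have hKc : K.card = k := (Finset.mem_powersetCard.1 hK).2
      refine (measureReal_biUnion_finset_le _ _).trans (Finset.sum_le_sum fun q hq => ?_)
      obtain ⟨i1, i2, i3⟩ := hI K hKc
      refine (W_bound ε μ hε0.le hμ.le K (I K) q (hQ1 q hq) i2 i3).trans ?_
      rw [hKc, i1]
      have hMp := Mg_pos (-μ)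
      refine mul_le_mul_of_nonneg_left ?_ (by positivity)
      exact pow_le_pow_left₀ (by linarith) (by linarith) _
    refine s1.trans ?_
    simp only [Finset.sum_const, Finset.card_powersetCard, Finset.card_univ, Fintype.card_fin,
      nsmul_eq_mul]
    have hAp : 0 < A := by linarith
    have hBt : 0 < B + t := by linarith
    rw [pow_eq_exp hAp, pow_eq_exp hBt, ← hy]
    have s2 := choose_bound β hβ0 hβ1 n k hkn
    have s3 : (n.choose k : ℝ) * (Q.card * (Real.exp ((m * k : ℕ) * Real.log A) * Real.exp (p * y))) ≤
        Q.card * Real.exp ((k * y1 + ((n : ℝ) - k) * y2) + (((m * k : ℕ) * Real.log A) + p * y)) := by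
      rw [Real.exp_add (_ + _), Real.exp_add (_ * _) (p * y)]
      have := mul_le_mul_of_nonneg_right s2 (show 0 ≤ (Q.card * (Real.exp ((m * k : ℕ) * Real.log A) * Real.exp (p * y))) by positivity)
      linarith
    refine s3.trans ?_
    have s4 : (k * y1 + ((n : ℝ) - k) * y2) + (((m * k : ℕ) * Real.log A) + p * y) ≤
        (y2 + 2 * |y|) + F * n := by
      have u1 : k * y1 ≤ β * n * y1 := mul_le_mul_of_nonneg_right hk1 hl1.le
      have u2 : ((n : ℝ) - k) * y2 ≤ (n - β * n + 1) * y2 :=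
        mul_le_mul_of_nonneg_right (by linarith) hl2.le
      have u3 : ((m * k : ℕ) : ℝ) * Real.log A ≤ (m * (β * n)) * Real.log A := by
        push_cast
        exact mul_le_mul_of_nonneg_right (mul_le_mul_of_nonneg_left hk1 (by positivity)) hLA
      have u4 : (p : ℝ) * y ≤ (n * D - β * n) * y + 2 * |y| := by
        have v1 : 0 ≤ (p : ℝ) - (n * D - β * n) := by linarith
        have v2 : (p : ℝ) - (n * D - β * n) ≤ 2 := by linarith
        have v3 : ((p : ℝ) - (n * D - β * n)) * y ≤ ((p : ℝ) - (n * D - β * n)) * |y| :=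
          mul_le_mul_of_nonneg_left (le_abs_self y) v1
        have v4 := mul_le_mul_of_nonneg_right v2 (abs_nonneg y)
        linarith
      have : F * n = β * n * y1 + (n - β * n) * y2 + (m * (β * n)) * Real.log A + (n * D - β * n) * y := by
        rw [hF]; ring
      rw [this]
      linarith
    calc Q.card * Real.exp ((k * y1 + ((n : ℝ) - k) * y2) + (((m * k : ℕ) * Real.log A) + p * y))
        ≤ Q.card * Real.exp ((y2 + 2 * |y|) + F * n) := by
          refine mul_le_mul_of_nonneg_left (Real.exp_le_exp.2 s4) (by positivity)
      _ = C * Real.exp (F * n) := by rw [Real.exp_add, hC]; ring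
      _ ≤ Real.exp (-F / 2 * n) * Real.exp (F * n) :=
          mul_le_mul_of_nonneg_right hCn (Real.exp_pos _).le
      _ = Real.exp (F / 2 * n) := by rw [← Real.exp_add]; ring_nf
  have hcompl := probReal_compl_eq_one_sub (μ := gaussPi (n + m - 1)) hbm
  calc ENNReal.ofReal (1 - Real.exp (-(-F / 2) * n))
      ≤ ENNReal.ofReal ((gaussPi (n + m - 1)).real badᶜ) := by
        apply ENNReal.ofReal_le_ofReal
        rw [hcompl, show -(-F / 2) = F / 2 by ring]
        linarith
    _ = gaussPi (n + m - 1) badᶜ := ofReal_measureReal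
    _ ≤ _ := by
        apply measure_mono
        intro h hh
        refine good hm β ε (Q : Set (Fin m → ℝ)) k (fun s hs => Nat.le_floor hs) hkn
          (fun u hu => by simpa using hQ2 u hu) I (fun K hK => (hI K hK).2.2) h ?_
        intro K hK q hq
        by_contra hcon
        push Not at hcon
        apply hh
        simp only [hbad, Set.mem_iUnion]
        exact ⟨K, Finset.mem_powersetCard.2 ⟨Finset.subset_univ _, hK⟩, q, by simpa using hq, hcon⟩
end
end

section
/- Let m ≥ 1 be fixed and let 0 < δ < 1 be a constant. Fix z ∈ ℝ^m with ‖z‖₂ = 1. Then there exist a threshold β ∈ (0,1) and a constant c₃ > 0 (depending on m and β) such that, for all n sufficiently large, with probability at least 1 − e^{−c₃ n} the random n×m Toeplitz matrix H built from i.i.d. standard Gaussian N(0,1) inputs satisfies: for every subset K ⊆ {1,…,n} with |K| ≤ β n, ‖(Hz)_K‖₁ ≤ ((1−δ)/(2−δ)) ‖Hz‖₁. -/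
open MeasureTheory ProbabilityTheory Finset Filter

noncomputable section

lemma sum_mgf {Ω : Type*} [MeasurableSpace Ω] (μ : Measure Ω) [IsProbabilityMeasure μ] (f : Ω → ℝ)
    (t : ℝ) (hi : Integrable (fun x => Real.exp (t * f x)) μ) (d : ℕ) :
    Integrable (fun w : Fin d → Ω => Real.exp (t * ∑ k, f (w k))) (Measure.pi fun _ => μ) ∧
    mgf (fun w : Fin d → Ω => ∑ k, f (w k)) (Measure.pi fun _ => μ) t = (mgf f μ t) ^ d := by
  have h : (fun w : Fin d → Ω => Real.exp (t * ∑ k, f (w k))) =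
      fun w => ∏ k, Real.exp (t * f (w k)) := by
    ext w
    rw [← Real.exp_sum, mul_sum]
  refine ⟨?_, ?_⟩
  · rw [h]
    exact Integrable.fintype_prod (fun _ => hi)
  · unfold mgf
    rw [h]
    rw [integral_fintype_prod_eq_pow (ι := Fin d) (fun x => Real.exp (t * f x))]
    simp

lemma block_mp (μ : Measure ℝ) [IsProbabilityMeasure μ] {d q m : ℕ} (e : Fin q × Fin m → Fin d)
    (he : Function.Injective e) :
    MeasurePreserving (fun (h : Fin d → ℝ) (k : Fin q) (j : Fin m) => h (e (k, j)))
      (Measure.pi fun _ => μ) (Measure.pi fun _ => Measure.pi fun _ => μ) := by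
  refine ⟨by fun_prop, ?_⟩
  have h1 : iIndepFun (fun (i : Fin d) (h : Fin d → ℝ) => h i) (Measure.pi fun _ => μ) :=
    iIndepFun_pi (μ := fun _ : Fin d => μ) (X := fun _ => id) (fun i => aemeasurable_id)
  have h2 := h1.precomp he
  rw [iIndepFun_iff_map_fun_eq_pi_map (fun i => (measurable_pi_apply (e i)).aemeasurable)] at h2
  have h3 : ∀ i : Fin d, Measure.map (fun h : Fin d → ℝ => h i) (Measure.pi fun _ => μ) = μ :=
    fun i => (measurePreserving_eval (fun _ : Fin d => μ) i).map_eq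
  simp only [h3] at h2
  have h4 := Measure.infinitePi_map_curry (ι := Fin q) (κ := Fin m) (fun _ _ => μ)
  simp only [Measure.infinitePi_eq_pi] at h4
  rw [← h4, ← h2, Measure.map_map (by fun_prop) (by fun_prop)]
  rfl

lemma rho_lt {m : ℕ} (z : Fin m → ℝ) (hz : ∑ i, z i ^ 2 = 1) :
    mgf (fun w : Fin m → ℝ => |∑ j, w j * z j|) (Measure.pi fun _ => gaussianReal 0 1) (-1) < 1 := by
  set μ : Measure (Fin m → ℝ) := Measure.pi fun _ => gaussianReal 0 1 with hμ
  have hi : Integrable (fun w : Fin m → ℝ => Real.exp (-1 * |∑ j, w j * z j|)) μ := by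
    refine Integrable.of_bound (C := 1) (Measurable.aestronglyMeasurable (by fun_prop)) (ae_of_all _ fun w => ?_)
    simp
  by_contra! hcon
  have hnn : ∀ w : Fin m → ℝ, 0 ≤ 1 - Real.exp (-1 * |∑ j, w j * z j|) := fun w => by simp
  have h0 : ∫ w, (1 - Real.exp (-1 * |∑ j, w j * z j|)) ∂μ = 0 := by
    apply le_antisymm
    · rw [integral_sub (by fun_prop) hi]
      simp only [mgf] at hcon
      simp
      simpa using hcon
    · exact integral_nonneg fun w => by simp
  replace h0 := (integral_eq_zero_iff_of_nonneg (fun w => hnn w) ((integrable_const (1:ℝ)).sub hi)).1 h0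
  have hv : Var[∑ j, fun w : Fin m → ℝ => w j * z j; μ] = 1 := by
    rw [hμ, variance_sum_pi (X := fun j x => x * z j)]
    · have h1 : Var[fun x : ℝ => x; gaussianReal 0 1] = 1 := by
        have := @variance_id_gaussianReal 0 1
        simpa [Function.id_def] using this
      have h2 : ∀ i, Var[fun x : ℝ => x * z i; gaussianReal 0 1] = z i ^ 2 := by
        intro i
        have := variance_const_mul (z i) (fun x : ℝ => x) (gaussianReal 0 1)
        rw [h1, mul_one] at this
        rw [← this]
        congr 1
        ext x
        ring
      simp only [h2, hz]
    · intro i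
      exact (memLp_id_gaussianReal 2).mul_const (z i)
  have hz0 : (∑ j, fun w : Fin m → ℝ => w j * z j) =ᵐ[μ] fun _ => 0 := by
    filter_upwards [h0] with w hw
    simp only [Pi.sub_apply, Pi.zero_apply, sub_eq_zero] at hw
    have hw' := (Real.exp_eq_one_iff _).1 hw.symm
    simpa using hw'
  rw [variance_congr hz0] at hv
  have hv0 : Var[fun _ : Fin m → ℝ => (0:ℝ); μ] = 0 := variance_zero μ
  linarith

lemma lower {m : ℕ} (z : Fin m → ℝ) (hz : ∑ i, z i ^ 2 = 1) :
    ∃ c : ℝ, 0 < c ∧ ∀ (d q : ℕ) (e : Fin q × Fin m → Fin d), Function.Injective e →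
      (Measure.pi fun _ => gaussianReal 0 1).real
        {h : Fin d → ℝ | ∑ k, |∑ j, h (e (k, j)) * z j| ≤ c * q} ≤ Real.exp (-c * q) := by
  set f : (Fin m → ℝ) → ℝ := fun w => |∑ j, w j * z j| with hf
  have hfm : Measurable f := by fun_prop
  set ρ := mgf f (Measure.pi fun _ => gaussianReal 0 1) (-1) with hρ
  have hi : Integrable (fun w : Fin m → ℝ => Real.exp (-1 * f w)) (Measure.pi fun _ => gaussianReal 0 1) := by
    refine Integrable.of_bound (C := 1) (Measurable.aestronglyMeasurable (by fun_prop)) (ae_of_all _ fun w => ?_)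
    simp [hf]
  have h1 : ρ < 1 := rho_lt z hz
  have h0 : 0 < ρ := mgf_pos hi
  have hl := Real.log_neg h0 h1
  refine ⟨-Real.log ρ / 2, by linarith, fun d q e he => ?_⟩
  obtain ⟨g1, g2⟩ := sum_mgf _ f (-1) hi q
  have := measure_le_le_exp_mul_mgf (-Real.log ρ / 2 * q) (by norm_num) g1
  rw [g2, ← hρ] at this
  have mp := block_mp (gaussianReal 0 1) e he
  rw [← mp.measureReal_preimage (by
    apply MeasurableSet.nullMeasurableSet
    exact measurableSet_le (by fun_prop) (by fun_prop))] at this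
  refine this.trans (le_of_eq ?_)
  nth_rw 2 [← Real.exp_log h0]
  rw [← Real.exp_nat_mul, ← Real.exp_add]
  congr 1; ring

lemma upper : ∃ A : ℝ, 0 < A ∧ ∀ d : ℕ, (Measure.pi fun _ => gaussianReal 0 1).real
        {h : Fin d → ℝ | A * d ≤ ∑ k, (h k) ^ 2} ≤ Real.exp (-d) := by
  obtain ⟨t, ht, hi⟩ := IsGaussian.exists_integrable_exp_sq (gaussianReal 0 1)
  simp only [Real.norm_eq_abs, sq_abs] at hi
  set M := mgf (fun x : ℝ => x ^ 2) (gaussianReal 0 1) t with hM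
  have hM0 : 0 < M := mgf_pos hi
  refine ⟨(|Real.log M| + 1) / t, by positivity, fun d => ?_⟩
  obtain ⟨g1, g2⟩ := sum_mgf _ _ t hi d
  have := measure_ge_le_exp_mul_mgf ((|Real.log M| + 1) / t * d) ht.le g1
  rw [g2, ← hM] at this
  refine this.trans ?_
  nth_rw 2 [← Real.exp_log hM0]
  rw [← Real.exp_nat_mul, ← Real.exp_add]
  apply Real.exp_le_exp.2
  have : -t * ((|Real.log M| + 1) / t * d) = -(|Real.log M| + 1) * d := by field_simp
  rw [this]
  nlinarith [le_abs_self (Real.log M), (Nat.cast_nonneg d : (0:ℝ) ≤ d)]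

lemma upper_det {n m : ℕ} (z : Fin m → ℝ) (hz : ∑ i, z i ^ 2 = 1) (h : Fin (n + m - 1) → ℝ) :
    ∑ i, ((toeplitz n m h).mulVec z i) ^ 2 ≤ m * ∑ k, (h k) ^ 2 := by
  have h1 : ∀ i, ((toeplitz n m h).mulVec z i) ^ 2 ≤ ∑ j, (toeplitz n m h i j) ^ 2 := by
    intro i
    have := Finset.sum_mul_sq_le_sq_mul_sq univ (fun j => toeplitz n m h i j) z
    rw [hz, mul_one] at this
    exact this
  have h2 : ∀ j : Fin m, ∑ i, (toeplitz n m h i j) ^ 2 ≤ ∑ k, (h k) ^ 2 := by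
    intro j
    have hinj : Function.Injective (fun i : Fin n =>
        (⟨i.1 + j.1, by have := i.2; have := j.2; omega⟩ : Fin (n + m - 1))) := by
      intro a b hab
      simp only [Fin.mk.injEq] at hab
      ext; omega
    calc ∑ i, (toeplitz n m h i j) ^ 2 = ∑ k ∈ univ.map ⟨_, hinj⟩, (h k) ^ 2 := by
          rw [Finset.sum_map]; rfl
      _ ≤ _ := Finset.sum_le_univ_sum_of_nonneg (fun k => sq_nonneg _)
  calc _ ≤ ∑ i, ∑ j, (toeplitz n m h i j) ^ 2 := Finset.sum_le_sum fun i _ => h1 i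
    _ = ∑ j, ∑ i, (toeplitz n m h i j) ^ 2 := Finset.sum_comm
    _ ≤ ∑ j : Fin m, ∑ k, (h k) ^ 2 := Finset.sum_le_sum fun j _ => h2 j
    _ = _ := by simp

lemma idx_lt {n m k : ℕ} (hk : k < n / m) : m * k < n := by
  have : 0 < m := by
    rcases Nat.eq_zero_or_pos m with h | h
    · subst h; simp at hk
    · exact h
  have h2 : m * (n / m) ≤ n := Nat.mul_div_le n m
  have : m * k < m * (n / m) := by gcongr
  omega

def blk (n m : ℕ) (p : Fin (n / m) × Fin m) : Fin (n + m - 1) :=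
  ⟨m * p.1.1 + p.2.1, by have := idx_lt p.1.2; have := p.2.2; omega⟩

lemma blk_inj (n m : ℕ) : Function.Injective (blk n m) := by
  rintro ⟨a, b⟩ ⟨c, d⟩ hab
  simp only [blk, Fin.mk.injEq] at hab
  have h1 := congrArg (· / m) hab
  have hm : 0 < m := lt_of_le_of_lt (Nat.zero_le _) b.2
  simp only [Nat.mul_add_div hm, Nat.div_eq_of_lt b.2, Nat.div_eq_of_lt d.2, add_zero] at h1
  rw [h1] at hab
  ext <;> simp <;> omega

lemma lower_det {n m : ℕ} (hm : 1 ≤ m) (z : Fin m → ℝ) (h : Fin (n + m - 1) → ℝ) :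
    ∑ k, |∑ j, h (blk n m (k, j)) * z j| ≤ l1 ((toeplitz n m h).mulVec z) := by
  have hinj : Function.Injective (fun k : Fin (n / m) => (⟨m * k.1, idx_lt k.2⟩ : Fin n)) := by
    intro a b hab
    simp only [Fin.mk.injEq] at hab
    ext
    exact Nat.eq_of_mul_eq_mul_left hm hab
  calc _ = ∑ i ∈ univ.map ⟨_, hinj⟩, |(toeplitz n m h).mulVec z i| := by
          rw [Finset.sum_map]; rfl
      _ ≤ _ := Finset.sum_le_univ_sum_of_nonneg (fun k => abs_nonneg _)

/-- For a fixed unit vector `z` and constant `0 < δ < 1`, there are a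
threshold `β ∈ (0,1)` and a constant `c₃ > 0` such that, with probability at least
`1 - e^{-c₃ n}` for large `n`, the Gaussian Toeplitz matrix satisfies
`‖(Hz)_K‖₁ ≤ ((1-δ)/(2-δ))‖Hz‖₁` for all `K` with `|K| ≤ β n`. -/
theorem stmt3 (m : ℕ) (hm : 1 ≤ m) (δ : ℝ) (hδ0 : 0 < δ) (hδ1 : δ < 1)
    (z : Fin m → ℝ) (hz : l2 z = 1) :
    ∃ β : ℝ, 0 < β ∧ β < 1 ∧ ∃ c₃ : ℝ, 0 < c₃ ∧ ∃ N : ℕ, ∀ n : ℕ, N ≤ n → m ≤ n →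
      ENNReal.ofReal (1 - Real.exp (-c₃ * n)) ≤
        gaussPi (n + m - 1)
          {h | ∀ K : Finset (Fin n), (K.card : ℝ) ≤ β * n →
            ∑ i ∈ K, |(toeplitz n m h).mulVec z i| ≤
              (1 - δ) / (2 - δ) * l1 ((toeplitz n m h).mulVec z)} := by

  have hz' : ∑ i, z i ^ 2 = 1 := by
    unfold l2 at hz
    exact Real.sqrt_eq_one.1 hz
  obtain ⟨c, hc, hlow⟩ := lower z hz'
  obtain ⟨A, hA, hup⟩ := upper
  have hmp : (0:ℝ) < m := by exact_mod_cast hm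
  set κ := (1 - δ) / (2 - δ) with hκ
  have hκ0 : 0 < κ := div_pos (by linarith) (by linarith)
  set a := c / (2 * m) with ha
  have ha0 : 0 < a := by positivity
  set β := min (1 / 2) ((κ * a) ^ 2 / (2 * m * A)) with hβ
  have hβ0 : 0 < β := lt_min (by norm_num) (by positivity)
  set c₃ := min 1 a / 2 with hc3
  have hc30 : 0 < c₃ := by have := lt_min one_pos ha0; positivity
  refine ⟨β, hβ0, lt_of_le_of_lt (min_le_left _ _) (by norm_num), c₃, hc30,
    ⌈1 / c₃⌉₊, fun n hN hmn => ?_⟩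
  have hn1 : 1 ≤ n := hm.trans hmn
  have hnp : (0:ℝ) < n := by exact_mod_cast hn1
  have hNc : 1 ≤ c₃ * n := by
    have h1 : 1 / c₃ ≤ n := (Nat.le_ceil _).trans (by exact_mod_cast hN)
    rwa [div_le_iff₀' hc30] at h1
  set d := n + m - 1 with hd
  have hdn : (n:ℝ) ≤ d := by exact_mod_cast (by omega : n ≤ n + m - 1)
  have hd2 : (d:ℝ) ≤ 2 * n := by exact_mod_cast (by omega : n + m - 1 ≤ 2 * n)
  have hq : a * n ≤ c * (n / m : ℕ) := by
    have h1 : n ≤ 2 * m * (n / m) := by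
      have e1 := Nat.div_add_mod n m
      have e2 := Nat.mod_lt n (by omega : m > 0)
      have e3 : 1 ≤ n / m := (Nat.one_le_div_iff (by omega)).2 hmn
      nlinarith
    have h2 : (n:ℝ) ≤ 2 * m * (n / m : ℕ) := by exact_mod_cast h1
    rw [ha, div_mul_eq_mul_div, div_le_iff₀ (by positivity)]
    nlinarith
  set B1 : Set (Fin d → ℝ) :=
    {h | ∑ k, |∑ j, h (blk n m (k, j)) * z j| ≤ c * (n / m : ℕ)} with hB1
  set B2 : Set (Fin d → ℝ) := {h | A * d ≤ ∑ k, (h k) ^ 2} with hB2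
  have hp1 : (gaussPi d).real B1 ≤ Real.exp (-a * n) := by
    refine (hlow d (n / m) (blk n m) (blk_inj n m)).trans (Real.exp_le_exp.2 ?_)
    linarith
  have hp2 : (gaussPi d).real B2 ≤ Real.exp (-n) :=
    (hup d).trans (Real.exp_le_exp.2 (by linarith))
  haveI : IsProbabilityMeasure (gaussPi d) := by unfold gaussPi; infer_instance
  have hm1 : MeasurableSet B1 := measurableSet_le (by fun_prop) (by fun_prop)
  have hm2 : MeasurableSet B2 := measurableSet_le (by fun_prop) (by fun_prop)
  have hsum : (gaussPi d).real (B1 ∪ B2) ≤ Real.exp (-c₃ * n) := by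
    refine (measureReal_union_le _ _).trans ((add_le_add hp1 hp2).trans ?_)
    have k1 : Real.exp (-a * n) ≤ Real.exp (-c₃ * n) * Real.exp (-c₃ * n) := by
      rw [← Real.exp_add]
      apply Real.exp_le_exp.2
      have : 2 * c₃ ≤ a := by rw [hc3]; linarith [min_le_right 1 a]
      nlinarith
    have k2 : Real.exp (-n) ≤ Real.exp (-c₃ * n) * Real.exp (-c₃ * n) := by
      rw [← Real.exp_add]
      apply Real.exp_le_exp.2
      have : 2 * c₃ ≤ 1 := by rw [hc3]; linarith [min_le_left 1 a]
      nlinarith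
    have k3 : Real.exp (-c₃ * n) ≤ 1 / 2 := by
      rw [neg_mul, Real.exp_neg, ← one_div]
      apply one_div_le_one_div_of_le (by norm_num)
      linarith [Real.add_one_le_exp (c₃ * n)]
    nlinarith [Real.exp_pos (-c₃ * n)]
  have hbig : 1 - Real.exp (-c₃ * n) ≤ (gaussPi d).real (B1 ∪ B2)ᶜ := by
    rw [probReal_compl_eq_one_sub (hm1.union hm2)]
    linarith
  refine (ENNReal.ofReal_le_ofReal hbig).trans ?_
  rw [ofReal_measureReal]
  apply measure_mono
  intro h hh K hK
  simp only [Set.mem_compl_iff, Set.mem_union, not_or, hB1, hB2, Set.mem_setOf_eq, not_le] at hh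
  obtain ⟨hh1, hh2⟩ := hh
  have hl : a * n ≤ l1 ((toeplitz n m h).mulVec z) :=
    hq.trans (hh1.le.trans (lower_det hm z h))
  refine le_trans ?_ (mul_le_mul_of_nonneg_left hl hκ0.le)
  have s0 : 0 ≤ κ * (a * n) := by positivity
  refine (pow_le_pow_iff_left₀ (Finset.sum_nonneg fun i _ => abs_nonneg _) s0 two_ne_zero).1 ?_
  have s1 : (∑ i ∈ K, |(toeplitz n m h).mulVec z i|) ^ 2 ≤
      K.card * ∑ i ∈ K, |(toeplitz n m h).mulVec z i| ^ 2 := sq_sum_le_card_mul_sum_sq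
  simp only [sq_abs] at s1
  have s2 : ∑ i ∈ K, ((toeplitz n m h).mulVec z i) ^ 2 ≤ m * (A * (2 * n)) := by
    refine (Finset.sum_le_univ_sum_of_nonneg (fun k => sq_nonneg _)).trans
      ((upper_det z hz' h).trans ?_)
    gcongr
    exact hh2.le.trans (by gcongr)
  have s3 : β * (2 * m * A) ≤ (κ * a) ^ 2 := by
    rw [← le_div_iff₀ (by positivity)]
    exact min_le_right _ _
  calc _ ≤ _ := s1
    _ ≤ (β * n) * (m * (A * (2 * n))) := by gcongr
    _ = (β * (2 * m * A)) * n ^ 2 := by ring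
    _ ≤ (κ * a) ^ 2 * n ^ 2 := by gcongr
    _ = _ := by ring
end
end

section
/- Let m ≥ 1 be fixed and let 0 < β < 1 be an arbitrary constant. For each n ≥ m, let H be the random n×m Toeplitz matrix built from i.i.d. standard Gaussian N(0,1) inputs, let x ∈ ℝ^m, and let e ∈ ℝ^n be a (deterministic, arbitrary) vector with at most k = βn nonzero entries. Let x̂ be any minimizer of z ↦ ‖(Hx + e) − Hz‖₁ over z ∈ ℝ^m. Then the probability that x̂ = x tends to 1 as n → ∞. -/
open MeasureTheory ProbabilityTheory Finset Filter

noncomputable section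

instance gaussPi_prob (d : ℕ) : IsProbabilityMeasure (gaussPi d) := by
  unfold gaussPi; infer_instance

lemma row_map (n m : ℕ) (i : Fin n) :
    MeasurePreserving (fun h => toeplitz n m h i) (gaussPi (n + m - 1)) (gaussPi m) := by
  have hmeas : Measurable (fun h : Fin (n + m - 1) → ℝ => toeplitz n m h i) := by
    unfold toeplitz; fun_prop
  refine ⟨hmeas, ?_⟩
  have h0 : iIndepFun (fun (a : Fin (n+m-1)) (ω : Fin (n + m - 1) → ℝ) => ω a)
      (gaussPi (n + m - 1)) :=
    iIndepFun_pi (X := fun _ => id) (fun _ => aemeasurable_id)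
  have h1 := h0.precomp (g := fun j : Fin m => (⟨i.1 + j.1, by have := i.2; have := j.2; omega⟩ : Fin (n+m-1)))
    (by intro a b hab; simp at hab; exact Fin.ext hab)
  have h2 := h1.map_fun_eq_pi_map (fun j => (measurable_pi_apply _).aemeasurable)
  have h3 : (fun h => toeplitz n m h i) = fun (ω : Fin (n + m - 1) → ℝ) (j : Fin m) => ω ⟨i.1 + j.1, by have := i.2; have := j.2; omega⟩ := rfl
  rw [h3, h2]
  unfold gaussPi
  congr 1
  funext j
  exact (measurePreserving_eval (fun _ : Fin (n+m-1) => gaussianReal 0 1) _).map_eq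

lemma row_indep (n m : ℕ) (i i' : Fin n) (hii : i.1 + m ≤ i'.1) :
    IndepFun (fun h => toeplitz n m h i) (fun h => toeplitz n m h i') (gaussPi (n + m - 1)) := by
  classical
  have h0 : iIndepFun (fun (a : Fin (n+m-1)) (ω : Fin (n + m - 1) → ℝ) => ω a)
      (gaussPi (n + m - 1)) :=
    iIndepFun_pi (X := fun _ => id) (fun _ => aemeasurable_id)
  have h1 := h0.indepFun_finset (Finset.univ.filter fun a => a.1 < i'.1)
    (Finset.univ.filter fun a => i'.1 ≤ a.1)
    (by
      rw [Finset.disjoint_left]; intro a ha hb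
      simp at ha hb; omega) (fun a => measurable_pi_apply a)
  exact h1.comp
    (φ := fun g (j : Fin m) => g ⟨⟨i.1 + j.1, by have := i.2; have := j.2; omega⟩, by
      simp; omega⟩)
    (ψ := fun g (j : Fin m) => g ⟨⟨i'.1 + j.1, by have := i'.2; have := j.2; omega⟩, by
      simp⟩)
    (measurable_pi_lambda _ fun j => measurable_pi_apply _)
    (measurable_pi_lambda _ fun j => measurable_pi_apply _)

lemma cross (n m : ℕ) (B : ℝ) (F : Fin n → (Fin m → ℝ) → ℝ)
    (hF : ∀ i, Measurable (F i)) (hL : ∀ i, MemLp (F i) 2 (gaussPi m))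
    (h0 : ∀ i, ∫ v, F i v ∂(gaussPi m) = 0)
    (hB : ∀ i, ∫ v, (F i v)^2 ∂(gaussPi m) ≤ B) (i i' : Fin n) :
    ∫ h, F i (toeplitz n m h i) * F i' (toeplitz n m h i') ∂(gaussPi (n+m-1)) ≤
      if (i.1 < i'.1 + m ∧ i'.1 < i.1 + m) then B else 0 := by
  have key : ∀ i, MemLp (fun h => F i (toeplitz n m h i)) 2 (gaussPi (n+m-1)) := fun i =>
    (hL i).comp_measurePreserving (row_map n m i)
  have e1 : ∀ i, ∫ h, F i (toeplitz n m h i) ∂(gaussPi (n+m-1)) = 0 := by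
    intro i
    rw [← h0 i, ← (row_map n m i).map_eq, integral_map (row_map n m i).measurable.aemeasurable
      (hF i).aestronglyMeasurable]
  have e2 : ∀ i, ∫ h, (F i (toeplitz n m h i))^2 ∂(gaussPi (n+m-1)) ≤ B := by
    intro i
    refine le_trans (le_of_eq ?_) (hB i)
    rw [← (row_map n m i).map_eq, integral_map (row_map n m i).measurable.aemeasurable
      ((hF i).pow_const 2).aestronglyMeasurable]
  split_ifs with hc
  · have : ∫ h, F i (toeplitz n m h i) * F i' (toeplitz n m h i') ∂(gaussPi (n+m-1)) ≤
      ∫ h, ((F i (toeplitz n m h i))^2 + (F i' (toeplitz n m h i'))^2) / 2 ∂(gaussPi (n+m-1)) := by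
      apply integral_mono
      · exact (key i).integrable_mul (key i')
      · exact ((key i).integrable_sq.add (key i').integrable_sq).div_const 2
      · intro h
        have := sq_nonneg (F i (toeplitz n m h i) - F i' (toeplitz n m h i'))
        simp only
        nlinarith
    rw [integral_div, integral_add (key i).integrable_sq (key i').integrable_sq] at this
    linarith [e2 i, e2 i']
  · have hind : IndepFun (fun h => F i (toeplitz n m h i)) (fun h => F i' (toeplitz n m h i'))
        (gaussPi (n+m-1)) := by
      by_cases hle : i.1 + m ≤ i'.1
      · exact (row_indep n m i i' hle).comp (hF i) (hF i')
      · exact ((row_indep n m i' i (by omega)).comp (hF i') (hF i)).symm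
    rw [hind.integral_fun_mul_eq_mul_integral (key i).1 (key i').1, e1]
    simp

lemma cheb (n m : ℕ) (B : ℝ) (hBpos : 0 ≤ B) (F : Fin n → (Fin m → ℝ) → ℝ)
    (hF : ∀ i, Measurable (F i)) (hL : ∀ i, MemLp (F i) 2 (gaussPi m))
    (h0 : ∀ i, ∫ v, F i v ∂(gaussPi m) = 0)
    (hB : ∀ i, ∫ v, (F i v)^2 ∂(gaussPi m) ≤ B) (ε : ℝ) (hε : 0 < ε) (hn : 0 < n) :
    (gaussPi (n+m-1)) {h | ε * n ≤ |∑ i, F i (toeplitz n m h i)|} ≤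
      ENNReal.ofReal ((2 * m * B / ε^2) * (1 / n)) := by
  have key : ∀ i, MemLp (fun h => F i (toeplitz n m h i)) 2 (gaussPi (n+m-1)) := fun i =>
    (hL i).comp_measurePreserving (row_map n m i)
  have kM : ∀ i i', Integrable (fun h => F i (toeplitz n m h i) * F i' (toeplitz n m h i'))
      (gaussPi (n+m-1)) := fun i i' => (key i).integrable_mul (key i')
  have kS : MemLp (fun h => ∑ i, F i (toeplitz n m h i)) 2 (gaussPi (n+m-1)) :=
    memLp_finsetSum _ (fun i _ => key i)
  have hsum : ∫ h, (∑ i, F i (toeplitz n m h i))^2 ∂(gaussPi (n+m-1)) ≤ n * (2 * m * B) := by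
    have : ∀ h, (∑ i, F i (toeplitz n m h i))^2 =
        ∑ i, ∑ i', F i (toeplitz n m h i) * F i' (toeplitz n m h i') := by
      intro h; rw [sq, Finset.sum_mul_sum]
    simp_rw [this]
    rw [integral_finsetSum _ (fun i _ => integrable_finsetSum _ (fun i' _ => kM i i'))]
    have : ∀ i : Fin n, ∫ h, ∑ i', F i (toeplitz n m h i) * F i' (toeplitz n m h i') ∂(gaussPi (n+m-1)) ≤ 2 * m * B := by
      intro i
      rw [integral_finsetSum _ (fun i' _ => kM i i')]
      refine (Finset.sum_le_sum (fun i' _ => cross n m B F hF hL h0 hB i i')).trans ?_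
      rw [← Finset.sum_filter, Finset.sum_const, nsmul_eq_mul]
      refine mul_le_mul_of_nonneg_right ?_ hBpos
      have : (Finset.univ.filter fun i' : Fin n => i.1 < i'.1 + m ∧ i'.1 < i.1 + m).card ≤ 2 * m := by
        have h1 : ((Finset.univ.filter fun i' : Fin n => i.1 < i'.1 + m ∧ i'.1 < i.1 + m).map Fin.valEmbedding) ⊆ Finset.Ico (i.1 + 1 - m) (i.1 + m) := by
          intro a ha
          simp only [Finset.mem_map, Finset.mem_filter, Finset.mem_univ, true_and, Fin.valEmbedding_apply] at ha
          obtain ⟨b, hb, rfl⟩ := ha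
          simp; omega
        have := Finset.card_le_card h1
        rw [Finset.card_map, Nat.card_Ico] at this
        omega
      exact_mod_cast this
    refine (Finset.sum_le_sum (fun i _ => this i)).trans ?_
    simp
  have hnr : (0:ℝ) < n := by exact_mod_cast hn
  have hm1 := mul_meas_ge_le_integral_of_nonneg (μ := gaussPi (n+m-1))
    (f := fun h => (∑ i, F i (toeplitz n m h i))^2) (Eventually.of_forall fun h => sq_nonneg _)
    kS.integrable_sq ((ε * n)^2)
  have hset : {h : Fin (n+m-1) → ℝ | ε * n ≤ |∑ i, F i (toeplitz n m h i)|} =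
      {h | (ε * n)^2 ≤ (∑ i, F i (toeplitz n m h i))^2} := by
    ext h
    simp only [Set.mem_ofPred_eq]
    rw [sq_le_sq, abs_of_pos (mul_pos hε hnr)]
  rw [hset, ← ENNReal.ofReal_toReal (measure_ne_top (gaussPi (n+m-1)) _)]
  apply ENNReal.ofReal_le_ofReal
  have h3 := hm1.trans hsum
  rw [← measureReal_def]
  have h4 : (2 * m * B / ε^2) * (1 / n) = (n * (2 * m * B)) / (ε * n)^2 := by
    field_simp
  rw [h4, le_div_iff₀ (by positivity), mul_comm]
  exact h3

def qq (t : ℝ) : ℝ := (1 + t ^ 2)⁻¹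

def chi {m : ℕ} (v : Fin m → ℝ) : ℝ := ∏ a, qq (v a)

lemma qq_pos (t : ℝ) : 0 < qq t := by unfold qq; positivity

lemma qq_le (t : ℝ) : qq t ≤ 1 := by
  unfold qq; exact inv_le_one_of_one_le₀ (by nlinarith [sq_nonneg t])

lemma qq_sq (t : ℝ) : qq t * t ^ 2 ≤ 1 := by
  unfold qq
  rw [inv_mul_le_iff₀ (by positivity)]; linarith

lemma qq_abs (t : ℝ) : qq t * |t| ≤ 1 := by
  unfold qq
  rw [inv_mul_le_iff₀ (by positivity)]
  nlinarith [sq_abs t, sq_nonneg (|t| - 1)]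

lemma qq_cont : Continuous qq := by
  unfold qq
  exact Continuous.inv₀ (by fun_prop) (fun t => by positivity)

lemma chi_pos {m : ℕ} (v : Fin m → ℝ) : 0 < chi v := Finset.prod_pos fun a _ => qq_pos _

lemma chi_cont {m : ℕ} : Continuous (chi : (Fin m → ℝ) → ℝ) := by
  unfold chi
  exact continuous_finsetProd _ fun a _ => qq_cont.comp (continuous_apply a)

lemma chi_le {m : ℕ} (v : Fin m → ℝ) (j : Fin m) : chi v ≤ qq (v j) := by
  unfold chi
  rw [← Finset.mul_prod_erase _ _ (Finset.mem_univ j)]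
  exact mul_le_of_le_one_right (qq_pos _).le
    (Finset.prod_le_one (fun a _ => (qq_pos _).le) (fun a _ => qq_le _))

lemma chi_abs {m : ℕ} (v : Fin m → ℝ) (j : Fin m) : chi v * |v j| ≤ 1 :=
  (mul_le_mul_of_nonneg_right (chi_le v j) (abs_nonneg _)).trans (qq_abs _)

lemma chi_sq {m : ℕ} (v : Fin m → ℝ) (j : Fin m) : chi v * (v j) ^ 2 ≤ 1 :=
  (mul_le_mul_of_nonneg_right (chi_le v j) (sq_nonneg _)).trans (qq_sq _)

lemma chi_two {m : ℕ} (v : Fin m → ℝ) (j l : Fin m) : |chi v * v j * v l| ≤ 1 := by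
  have h1 := chi_sq v j
  have h2 := chi_sq v l
  have h3 := mul_nonneg (chi_pos v).le (sq_nonneg (v j - v l))
  have h4 := mul_nonneg (chi_pos v).le (sq_nonneg (v j + v l))
  rw [abs_le]; constructor <;> nlinarith

lemma gauss_q_odd : ∫ t, qq t * t ∂(gaussianReal 0 1) = 0 := by
  have h := gaussianReal_map_neg (μ := 0) (v := 1)
  rw [neg_zero] at h
  have h2 : ∫ t, qq t * t ∂(gaussianReal 0 1) = ∫ t, qq (-t) * (-t) ∂(gaussianReal 0 1) := by
    conv_lhs => rw [← h]
    exact integral_map (f := fun t => qq t * t) (measurable_neg.aemeasurable)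
      ((qq_cont.mul continuous_id).aestronglyMeasurable)
  have h3 : ∀ t, qq (-t) * (-t) = -(qq t * t) := by intro t; simp [qq]
  simp_rw [h3] at h2
  rw [integral_neg] at h2
  linarith

lemma gauss_q0 : 0 < ∫ t, qq t ∂(gaussianReal 0 1) := by
  rw [integral_pos_iff_support_of_nonneg (fun t => (qq_pos t).le)]
  · have : Function.support qq = Set.univ := by ext t; simp [(qq_pos t).ne']
    rw [this]; simp
  · refine Integrable.of_bound qq_cont.aestronglyMeasurable 1 (Eventually.of_forall fun t => ?_)
    rw [Real.norm_eq_abs, abs_of_pos (qq_pos t)]; exact qq_le t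

lemma gauss_q2 : 0 < ∫ t, qq t * t * t ∂(gaussianReal 0 1) := by
  rw [integral_pos_iff_support_of_nonneg (fun t => by
    have := mul_nonneg (qq_pos t).le (mul_self_nonneg t)
    simpa [mul_assoc] using this)]
  · have : Function.support (fun t => qq t * t * t) = {0}ᶜ := by ext t; simp [(qq_pos t).ne']
    have hna : NullSingletonClass (gaussianReal 0 1) :=
      nullSingletonClass_gaussianReal one_ne_zero
    have hz : gaussianReal 0 1 {(0:ℝ)} = 0 := measure_singleton 0
    rw [this, prob_compl_eq_one_sub (measurableSet_singleton 0), hz]; simp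
  · refine Integrable.of_bound (by have := qq_cont; fun_prop) 1 (Eventually.of_forall fun t => ?_)
    have h := qq_sq t
    have h2 := mul_nonneg (qq_pos t).le (sq_nonneg t)
    rw [Real.norm_eq_abs, abs_le]
    constructor <;> nlinarith

lemma chi_int (m : ℕ) (hm : 1 ≤ m) : ∃ c : ℝ, 0 < c ∧ ∀ j l : Fin m,
    ∫ v, chi v * v j * v l ∂(gaussPi m) = if j = l then c else 0 := by
  classical
  set p0 := ∫ t, qq t ∂(gaussianReal 0 1) with hp0
  set p2 := ∫ t, qq t * t * t ∂(gaussianReal 0 1) with hp2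
  refine ⟨p2 * p0 ^ (m - 1), mul_pos gauss_q2 (pow_pos gauss_q0 _), ?_⟩
  intro j l
  have h1 : ∀ v : Fin m → ℝ, chi v * v j * v l =
      ∏ a, (qq (v a) * (if a = j then v a else 1) * (if a = l then v a else 1)) := by
    intro v
    rw [Finset.prod_mul_distrib, Finset.prod_mul_distrib]
    simp [chi]
  simp_rw [h1]
  unfold gaussPi
  rw [integral_fintype_prod_eq_prod (fun (a : Fin m) (t : ℝ) =>
    (qq t * (if a = j then t else 1) * (if a = l then t else 1)))]
  split_ifs with hjl
  · subst hjl
    rw [← Finset.mul_prod_erase _ _ (Finset.mem_univ j)]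
    have : ∀ a ∈ Finset.univ.erase j, ∫ t, (qq t * (if a = j then t else 1) * (if a = j then t else 1)) ∂(gaussianReal 0 1) = p0 := by
      intro a ha
      simp [(Finset.mem_erase.1 ha).1, hp0]
    rw [Finset.prod_congr rfl this]
    simp [hp2]
  · apply Finset.prod_eq_zero (Finset.mem_univ j)
    simp [hjl, gauss_q_odd]

lemma determ (n m : ℕ) (hn : 0 < n) (hm : 1 ≤ m) (c β ε : ℝ) (hc : 0 < c) (hβ1 : β < 1)
    (hε : ε = c * (1 - β) / (3 * m)) (R : Fin n → Fin m → ℝ) (e : Fin n → ℝ)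
    (hN : (1 - β) * n ≤ ∑ i, (if e i = 0 then (1:ℝ) else 0))
    (hS : ∀ j, |∑ i, Real.sign (e i) * R i j| < ε * n)
    (hG : ∀ j l, |∑ i, (if e i = 0 then (1:ℝ) else 0) *
      (chi (R i) * R i j * R i l - if j = l then c else 0)| < ε * n)
    (w : Fin m → ℝ) (hw : ∑ i, |e i - ∑ j, R i j * w j| ≤ ∑ i, |e i|) : w = 0 := by
  by_contra hne
  set W := ∑ j, |w j| with hW
  have hWpos : 0 < W := by
    obtain ⟨j, hj⟩ := Function.ne_iff.1 hne
    exact lt_of_lt_of_le (abs_pos.2 hj)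
      (Finset.single_le_sum (f := fun j => |w j|) (fun _ _ => abs_nonneg _) (Finset.mem_univ j))
  have hnr : (0:ℝ) < n := by exact_mod_cast hn
  have hmr : (0:ℝ) < m := by exact_mod_cast hm
  have hεpos : 0 < ε := by
    rw [hε]; exact div_pos (mul_pos hc (by linarith)) (by positivity)
  set y : Fin n → ℝ := fun i => ∑ j, R i j * w j with hy
  set a : Fin n → ℝ := fun i => if e i = 0 then (1:ℝ) else 0 with ha
  have ha0 : ∀ i, 0 ≤ a i := by intro i; simp only [ha]; split_ifs <;> norm_num
  -- step 1
  have s1 : ∑ i, a i * |y i| ≤ ∑ i, Real.sign (e i) * y i := by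
    have hp : ∀ i, |e i| - Real.sign (e i) * y i + a i * |y i| ≤ |e i - y i| := by
      intro i
      rcases lt_trichotomy (e i) 0 with h | h | h
      · simp only [ha, Real.sign_of_neg h, abs_of_neg h, if_neg h.ne]
        have := neg_abs_le (e i - y i)
        linarith
      · simp [ha, h]
      · simp only [ha, Real.sign_of_pos h, abs_of_pos h, if_neg h.ne']
        have := le_abs_self (e i - y i)
        linarith
    have := Finset.sum_le_sum (fun i (_ : i ∈ Finset.univ) => hp i)
    rw [Finset.sum_add_distrib, Finset.sum_sub_distrib] at this
    linarith
  have s2 : ∑ i, Real.sign (e i) * y i ≤ W * (ε * n) := by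
    have : ∑ i, Real.sign (e i) * y i = ∑ j, w j * ∑ i, Real.sign (e i) * R i j := by
      simp only [hy, Finset.mul_sum]
      rw [Finset.sum_comm]
      refine Finset.sum_congr rfl fun j _ => Finset.sum_congr rfl fun i _ => by ring
    rw [this, hW, Finset.sum_mul]
    refine Finset.sum_le_sum fun j _ => ?_
    refine (le_abs_self _).trans ?_
    rw [abs_mul]
    exact mul_le_mul_of_nonneg_left (hS j).le (abs_nonneg _)
  have s3 : ∑ i, a i * (chi (R i) * (y i)^2) ≤ (∑ i, a i * |y i|) * W := by
    rw [Finset.sum_mul]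
    refine Finset.sum_le_sum fun i _ => ?_
    rw [mul_assoc]
    refine mul_le_mul_of_nonneg_left ?_ (ha0 i)
    have hb : chi (R i) * |y i| ≤ W := by
      calc chi (R i) * |y i| ≤ chi (R i) * ∑ j, |R i j * w j| :=
            mul_le_mul_of_nonneg_left (Finset.abs_sum_le_sum_abs _ _) (chi_pos _).le
        _ = ∑ j, (chi (R i) * |R i j|) * |w j| := by
            rw [Finset.mul_sum]; refine Finset.sum_congr rfl fun j _ => by rw [abs_mul]; ring
        _ ≤ ∑ j, 1 * |w j| := Finset.sum_le_sum fun j _ =>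
            mul_le_mul_of_nonneg_right (chi_abs _ _) (abs_nonneg _)
        _ = W := by simp [hW]
    rw [← sq_abs (y i)]
    nlinarith [abs_nonneg (y i)]
  have s4 : ∑ i, a i * (chi (R i) * (y i)^2) =
      (∑ j, ∑ l, w j * w l * ∑ i, a i * (chi (R i) * R i j * R i l - if j = l then c else 0))
       + c * (∑ i, a i) * ∑ j, (w j)^2 := by
    have t1 : ∀ i, a i * (chi (R i) * (y i)^2) =
       (∑ j, ∑ l, w j * w l * (a i * (chi (R i) * R i j * R i l - if j = l then c else 0)))
        + c * a i * ∑ j, (w j)^2 := by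
      intro i
      have t2 : c * a i * ∑ j, (w j)^2 = ∑ j, ∑ l, w j * w l * (a i * if j = l then c else 0) := by
        simp only [mul_ite, mul_zero, Finset.sum_ite_eq, Finset.mem_univ, if_true, Finset.mul_sum]
        refine Finset.sum_congr rfl fun j _ => by ring
      rw [t2, ← Finset.sum_add_distrib]
      simp_rw [← Finset.sum_add_distrib]
      simp only [hy]
      rw [sq, Finset.sum_mul_sum, Finset.mul_sum, Finset.mul_sum]
      refine Finset.sum_congr rfl fun j _ => ?_
      rw [Finset.mul_sum, Finset.mul_sum]
      refine Finset.sum_congr rfl fun l _ => by ring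
    simp_rw [t1]
    rw [Finset.sum_add_distrib]
    congr 1
    · rw [Finset.sum_comm]
      refine Finset.sum_congr rfl fun j _ => ?_
      rw [Finset.sum_comm]
      refine Finset.sum_congr rfl fun l _ => ?_
      rw [Finset.mul_sum]
    · rw [← Finset.sum_mul, ← Finset.mul_sum]
  have s5 : -(W * W * (ε * n)) ≤
      (∑ j, ∑ l, w j * w l * ∑ i, a i * (chi (R i) * R i j * R i l - if j = l then c else 0)) := by
    have : W * W * (ε * n) = ∑ j, ∑ l, |w j| * |w l| * (ε * n) := by
      rw [hW, Finset.sum_mul_sum, Finset.sum_mul]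
      refine Finset.sum_congr rfl fun j _ => by rw [Finset.sum_mul]
    rw [this, ← Finset.sum_neg_distrib]
    refine Finset.sum_le_sum fun j _ => ?_
    rw [← Finset.sum_neg_distrib]
    refine Finset.sum_le_sum fun l _ => ?_
    refine le_trans ?_ (neg_abs_le _)
    rw [abs_mul, abs_mul]
    exact neg_le_neg (mul_le_mul_of_nonneg_left (hG j l).le (by positivity))
  have s6 : W ^ 2 ≤ m * ∑ j, (w j)^2 := by
    have := sq_sum_le_card_mul_sum_sq (s := (Finset.univ : Finset (Fin m))) (f := fun j => |w j|)
    simpa using this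
  have s7 : c * ((1 - β) * n) * ∑ j, (w j)^2 ≤ c * (∑ i, a i) * ∑ j, (w j)^2 :=
    mul_le_mul_of_nonneg_right (mul_le_mul_of_nonneg_left hN hc.le)
      (Finset.sum_nonneg fun _ _ => sq_nonneg _)
  have s8 : c * (1 - β) = 3 * m * ε := by rw [hε]; field_simp
  have s9 : (∑ i, a i * |y i|) * W ≤ W * (ε * n) * W :=
    mul_le_mul_of_nonneg_right (s1.trans s2) hWpos.le
  have s10 : 3 * (ε * n) * W^2 ≤ c * ((1 - β) * n) * ∑ j, (w j)^2 := by
    have : c * ((1 - β) * n) * ∑ j, (w j)^2 = 3 * (ε * n) * (m * ∑ j, (w j)^2) := by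
      rw [← mul_assoc c, s8]; ring
    rw [this]
    exact mul_le_mul_of_nonneg_left s6 (by positivity)
  have s11 : 0 < ε * n * W^2 := by positivity
  nlinarith

lemma gaussPi_coord (m : ℕ) (j : Fin m) :
    MeasurePreserving (fun v : Fin m → ℝ => v j) (gaussPi m) (gaussianReal 0 1) :=
  measurePreserving_eval (fun _ : Fin m => gaussianReal 0 1) j

lemma bad1 (n m : ℕ) (hn : 0 < n) (ε : ℝ) (hε : 0 < ε) (s : Fin n → ℝ) (hs : ∀ i, |s i| ≤ 1)
    (j : Fin m) : gaussPi (n+m-1) {h | ε * n ≤ |∑ i, s i * toeplitz n m h i j|} ≤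
      ENNReal.ofReal ((2 * m * 1 / ε^2) * (1 / n)) := by
  have hL : MemLp (fun v : Fin m → ℝ => v j) 2 (gaussPi m) :=
    (memLp_id_gaussianReal (μ := 0) (v := 1) 2).comp_measurePreserving (gaussPi_coord m j)
  have e1 : ∫ v, v j ∂(gaussPi m) = 0 := by
    have := integral_map (μ := gaussPi m) (φ := fun v => v j) (f := fun t : ℝ => t)
      (gaussPi_coord m j).measurable.aemeasurable (by fun_prop)
    rw [(gaussPi_coord m j).map_eq] at this
    rw [← this, integral_id_gaussianReal]
  have e2 : ∫ v, (v j)^2 ∂(gaussPi m) = 1 := by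
    have := integral_map (μ := gaussPi m) (φ := fun v => v j) (f := fun t : ℝ => t^2)
      (gaussPi_coord m j).measurable.aemeasurable (by fun_prop)
    rw [(gaussPi_coord m j).map_eq] at this
    rw [← this]
    have hv := variance_id_gaussianReal (μ := 0) (v := 1)
    rw [variance_of_integral_eq_zero (by fun_prop) (by simp [integral_id_gaussianReal])] at hv
    simpa using hv
  refine cheb n m 1 zero_le_one (fun i v => s i * v j) (fun i => by fun_prop)
    (fun i => hL.const_mul (s i)) (fun i => ?_) (fun i => ?_) ε hε hn
  · rw [integral_const_mul, e1, mul_zero]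
  · simp_rw [mul_pow]
    rw [integral_const_mul, e2, mul_one, sq_le_one_iff_abs_le_one]
    exact hs i

lemma bad2 (n m : ℕ) (hn : 0 < n) (ε : ℝ) (hε : 0 < ε) (a : Fin n → ℝ) (ha : ∀ i, |a i| ≤ 1)
    (c : ℝ) (hc : 0 < c) (j l : Fin m)
    (hcc : ∫ v, chi v * v j * v l ∂(gaussPi m) = if j = l then c else 0) :
    gaussPi (n+m-1) {h | ε * n ≤ |∑ i, a i * (chi (toeplitz n m h i) * toeplitz n m h i j
      * toeplitz n m h i l - if j = l then c else 0)|} ≤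
      ENNReal.ofReal ((2 * m * (1 + c)^2 / ε^2) * (1 / n)) := by
  set d : ℝ := if j = l then c else 0 with hd
  have hdc : |d| ≤ c := by
    rw [hd]; split_ifs
    · rw [abs_of_pos hc]
    · simp [hc.le]
  have hcont : Continuous (fun v : Fin m → ℝ => chi v * v j * v l) := by
    have := chi_cont (m := m); fun_prop
  have hint : Integrable (fun v : Fin m → ℝ => chi v * v j * v l) (gaussPi m) :=
    Integrable.of_bound hcont.aestronglyMeasurable 1 (Eventually.of_forall fun v => chi_two v j l)
  have hbd : ∀ i (v : Fin m → ℝ), |a i * (chi v * v j * v l - d)| ≤ 1 + c := by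
    intro i v
    rw [abs_mul]
    have h1 : |chi v * v j * v l - d| ≤ 1 + c :=
      (abs_sub _ _).trans (add_le_add (chi_two v j l) hdc)
    calc _ ≤ 1 * |chi v * v j * v l - d| := mul_le_mul_of_nonneg_right (ha i) (abs_nonneg _)
      _ ≤ _ := by rw [one_mul]; exact h1
  have hcont2 : ∀ i, Continuous (fun v : Fin m → ℝ => a i * (chi v * v j * v l - d)) := by
    intro i; fun_prop
  refine cheb n m ((1+c)^2) (sq_nonneg _) (fun i v => a i * (chi v * v j * v l - d))
    (fun i => (hcont2 i).measurable)
    (fun i => MemLp.of_bound (hcont2 i).aestronglyMeasurable (1 + c)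
      (Eventually.of_forall fun v => hbd i v)) (fun i => ?_) (fun i => ?_) ε hε hn
  · rw [integral_const_mul, integral_sub hint (integrable_const _), hcc]; simp
  · have hle : ∀ v : Fin m → ℝ, (a i * (chi v * v j * v l - d))^2 ≤ (1 + c)^2 := fun v =>
      sq_le_sq' (abs_le.1 (hbd i v)).1 (abs_le.1 (hbd i v)).2
    calc _ ≤ ∫ v : Fin m → ℝ, (1 + c)^2 ∂(gaussPi m) := by
          refine integral_mono_of_nonneg (Eventually.of_forall fun v => sq_nonneg _)
            (integrable_const _) (Eventually.of_forall hle)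
      _ = _ := by simp
/-- For fixed `m ≥ 1` and any constant `0 < β < 1`: for arbitrary
(deterministic) outlier vectors `e = e(n)` with at most `β n` nonzero entries, the
probability (over the Gaussian Toeplitz matrix) that every ℓ¹ minimizer `x̂` equals
the true parameter `x` tends to `1` as `n → ∞`. -/
theorem stmt5 (m : ℕ) (hm : 1 ≤ m) (β : ℝ) (hβ0 : 0 < β) (hβ1 : β < 1)
    (x : Fin m → ℝ) (e : (n : ℕ) → Fin n → ℝ)
    (he : ∀ n : ℕ, (sparsity (e n) : ℝ) ≤ β * n) :
    Filter.Tendsto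
      (fun n : ℕ =>
        gaussPi (n + m - 1)
          {h | ∀ xh : Fin m → ℝ,
            (∀ z : Fin m → ℝ,
              l1 ((toeplitz n m h).mulVec x + e n - (toeplitz n m h).mulVec xh) ≤
              l1 ((toeplitz n m h).mulVec x + e n - (toeplitz n m h).mulVec z)) →
            xh = x})
      Filter.atTop (nhds 1) := by
  classical
  obtain ⟨c, hc, hcc⟩ := chi_int m hm
  have hmr : (0:ℝ) < m := by exact_mod_cast hm
  obtain ⟨ε, hε⟩ : ∃ ε : ℝ, ε = c * (1 - β) / (3 * m) := ⟨_, rfl⟩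
  have hεpos : 0 < ε := by
    rw [hε]; exact div_pos (mul_pos hc (by linarith)) (by positivity)
  set D1 : ℝ := 2 * m * 1 / ε^2 with hD1
  set D2 : ℝ := 2 * m * (1 + c)^2 / ε^2 with hD2
  have hlow : ∀ᶠ n : ℕ in atTop, 1 - (∑ _j : Fin m, ENNReal.ofReal (D1 * (1 / n)) +
      ∑ _j : Fin m, ∑ _l : Fin m, ENNReal.ofReal (D2 * (1 / n))) ≤
      gaussPi (n + m - 1)
          {h | ∀ xh : Fin m → ℝ,
            (∀ z : Fin m → ℝ,
              l1 ((toeplitz n m h).mulVec x + e n - (toeplitz n m h).mulVec xh) ≤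
              l1 ((toeplitz n m h).mulVec x + e n - (toeplitz n m h).mulVec z)) →
            xh = x} := by
    filter_upwards [eventually_gt_atTop 0] with n hn
    set s : Fin n → ℝ := fun i => Real.sign (e n i) with hs
    set a : Fin n → ℝ := fun i => if e n i = 0 then (1:ℝ) else 0 with ha
    set B1 : Fin m → Set (Fin (n+m-1) → ℝ) := fun j =>
      {h | ε * n ≤ |∑ i, s i * toeplitz n m h i j|} with hB1
    set B2 : Fin m → Fin m → Set (Fin (n+m-1) → ℝ) := fun j l =>
      {h | ε * n ≤ |∑ i, a i * (chi (toeplitz n m h i) * toeplitz n m h i j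
      * toeplitz n m h i l - if j = l then c else 0)|} with hB2
    set Bad : Set (Fin (n+m-1) → ℝ) := (⋃ j, B1 j) ∪ ⋃ j, ⋃ l, B2 j l with hBad
    have hb : gaussPi (n+m-1) Bad ≤ ∑ _j : Fin m, ENNReal.ofReal (D1 * (1 / n)) +
      ∑ _j : Fin m, ∑ _l : Fin m, ENNReal.ofReal (D2 * (1 / n)) := by
      refine (measure_union_le _ _).trans (add_le_add ?_ ?_)
      · refine (measure_iUnion_fintype_le _ _).trans (Finset.sum_le_sum fun j _ => ?_)
        refine bad1 n m hn ε hεpos s (fun i => ?_) j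
        rcases Real.sign_apply_eq (e n i) with h | h | h <;> simp [hs, h]
      · refine (measure_iUnion_fintype_le _ _).trans (Finset.sum_le_sum fun j _ => ?_)
        refine (measure_iUnion_fintype_le _ _).trans (Finset.sum_le_sum fun l _ => ?_)
        refine bad2 n m hn ε hεpos a (fun i => ?_) c hc j l (hcc j l)
        simp only [ha]; split_ifs <;> simp
    have hgood : Badᶜ ⊆ {h | ∀ xh : Fin m → ℝ,
            (∀ z : Fin m → ℝ,
              l1 ((toeplitz n m h).mulVec x + e n - (toeplitz n m h).mulVec xh) ≤
              l1 ((toeplitz n m h).mulVec x + e n - (toeplitz n m h).mulVec z)) →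
            xh = x} := by
      intro h hh
      have hS : ∀ j, |∑ i, Real.sign (e n i) * toeplitz n m h i j| < ε * n := by
        intro j
        by_contra hcon
        exact hh (Or.inl (Set.mem_iUnion.2 ⟨j, not_lt.1 hcon⟩))
      have hG : ∀ j l, |∑ i, (if e n i = 0 then (1:ℝ) else 0) *
          (chi (toeplitz n m h i) * toeplitz n m h i j * toeplitz n m h i l
            - if j = l then c else 0)| < ε * n := by
        intro j l
        by_contra hcon
        exact hh (Or.inr (Set.mem_iUnion.2 ⟨j, Set.mem_iUnion.2 ⟨l, not_lt.1 hcon⟩⟩))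
      have hN : (1 - β) * n ≤ ∑ i, (if e n i = 0 then (1:ℝ) else 0) := by
        have h1 := he n
        have h2 : (∑ i, (if e n i = 0 then (1:ℝ) else 0)) + (sparsity (e n) : ℝ) = n := by
          have h3 := Finset.card_filter_add_card_filter_not (s := (Finset.univ : Finset (Fin n)))
            (fun i => e n i = 0)
          rw [Finset.sum_boole]
          unfold sparsity
          rw [Finset.card_univ, Fintype.card_fin] at h3
          exact_mod_cast h3
        linarith
      intro xh hmin
      have h0 := hmin x
      have hw := determ n m hn hm c β ε hc hβ1 hε (toeplitz n m h) (e n) hN hS hG (xh - x) (by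
        have e1 : ∀ i, ((toeplitz n m h).mulVec x + e n - (toeplitz n m h).mulVec xh) i =
            e n i - ∑ j, toeplitz n m h i j * (xh - x) j := by
          intro i
          simp only [Pi.add_apply, Pi.sub_apply, Matrix.mulVec, dotProduct, mul_sub,
            Finset.sum_sub_distrib]
          ring
        have e2 : ∀ i, ((toeplitz n m h).mulVec x + e n - (toeplitz n m h).mulVec x) i =
            e n i := by
          intro i; simp
        unfold l1 at h0
        simp_rw [e1, e2] at h0
        exact h0)
      exact sub_eq_zero.1 hw
    have hmB : MeasurableSet Bad := by
      have hT : ∀ i j, Measurable (fun h : Fin (n+m-1) → ℝ => toeplitz n m h i j) := by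
        intro i j; exact measurable_pi_apply _
      have hC : ∀ i, Measurable (fun h : Fin (n+m-1) → ℝ => chi (toeplitz n m h i)) := by
        intro i; exact chi_cont.measurable.comp (row_map n m i).measurable
      refine MeasurableSet.union (MeasurableSet.iUnion fun j => ?_)
        (MeasurableSet.iUnion fun j => MeasurableSet.iUnion fun l => ?_)
      · refine measurableSet_le measurable_const ?_
        exact (Finset.measurable_sum _ fun i _ => (hT i j).const_mul _).abs
      · refine measurableSet_le measurable_const ?_
        exact (Finset.measurable_sum _ fun i _ =>
          ((((hC i).mul (hT i j)).mul (hT i l)).sub_const _).const_mul _).abs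
    calc _ ≤ 1 - gaussPi (n+m-1) Bad := tsub_le_tsub_left hb _
      _ = gaussPi (n+m-1) Badᶜ := (prob_compl_eq_one_sub hmB).symm
      _ ≤ _ := measure_mono hgood
  have hz : ∀ D : ℝ, Tendsto (fun n : ℕ => ENNReal.ofReal (D * (1 / n))) atTop (nhds 0) := by
    intro D
    have h1 : Tendsto (fun n : ℕ => D * (1 / (n:ℝ))) atTop (nhds 0) := by
      simpa using (tendsto_one_div_atTop_nhds_zero_nat (𝕜 := ℝ)).const_mul D
    simpa using ENNReal.tendsto_ofReal h1
  have hlim : Tendsto (fun n : ℕ => 1 - (∑ _j : Fin m, ENNReal.ofReal (D1 * (1 / n)) +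
      ∑ _j : Fin m, ∑ _l : Fin m, ENNReal.ofReal (D2 * (1 / n)))) atTop (nhds 1) := by
    have h1 := (tendsto_finsetSum (Finset.univ : Finset (Fin m)) (fun _ _ => hz D1)).add
      (tendsto_finsetSum (Finset.univ : Finset (Fin m)) (fun _ _ =>
        tendsto_finsetSum (Finset.univ : Finset (Fin m)) (fun _ _ => hz D2)))
    have h2 := ENNReal.Tendsto.sub (tendsto_const_nhds (x := (1 : ENNReal)) (f := atTop (α := ℕ)))
      h1 (Or.inl ENNReal.one_ne_top)
    simpa using h2
  exact tendsto_of_tendsto_of_tendsto_of_le_of_le' hlim tendsto_const_nhds hlow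
    (Eventually.of_forall fun n => prob_le_one)
end
end

section
/- Let m ≥ 1 be fixed and n ≥ m. Let H be the random n×m Toeplitz matrix built from i.i.d. Rademacher inputs h_{-m+2},…,h_n (each equal to +1 or −1 with probability 1/2). Then there exist constants c₁ > 0 and β > 0 such that, with probability at least 1 − e^{−c₁ n} for all n sufficiently large, H has the property: for every x ∈ ℝ^m and every e ∈ ℝ^n whose support K satisfies |K| ≤ β n, x is the unique minimizer of z ↦ ‖(Hx + e) − Hz‖₁ over z ∈ ℝ^m. -/
open MeasureTheory ProbabilityTheory Finset Filter

noncomputable section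

/-- The Rademacher measure on ℝ: values `+1` and `-1` with probability `1/2` each. -/
def radMeasure : Measure ℝ :=
  (2 : ENNReal)⁻¹ • Measure.dirac 1 + (2 : ENNReal)⁻¹ • Measure.dirac (-1)

/-- Product of `d` i.i.d. Rademacher measures on `ℝ^d`. -/
def radPi (d : ℕ) : Measure (Fin d → ℝ) := Measure.pi fun _ => radMeasure

lemma hoeff_aux {Ω : Type*} [MeasurableSpace Ω] (μ : Measure Ω) [IsProbabilityMeasure μ]
    (L : ℕ) (A : Fin L → Set Ω) (hA : ∀ k, MeasurableSet (A k)) (hind : iIndepSet A μ)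
    (q : ℝ) (hq0 : 0 ≤ q) (hq : ∀ k, μ.real (A k) = q) :
    μ.real {ω | ∑ k, (A k).indicator (fun _ => (1:ℝ)) ω ≤ L * q / 2}
      ≤ Real.exp (-(L * q ^ 2 / 2)) := by
  have h1 : iIndepFun (fun k => (A k).indicator fun _ω => (1 : ℝ)) μ :=
    hind.iIndepFun_indicator
  have h2 : iIndepFun (fun k ω => -(A k).indicator (fun _ω => (1 : ℝ)) ω + q) μ :=
    h1.comp (fun _ x => -x + q) (fun _ => by fun_prop)
  have hint : ∀ k, ∫ ω, -(A k).indicator (fun _ω => (1 : ℝ)) ω ∂μ = -q := by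
    intro k
    rw [integral_neg, integral_indicator_const _ (hA k), hq k]
    simp
  have h3 : ∀ k ∈ (Finset.univ : Finset (Fin L)),
      HasSubgaussianMGF (fun ω => -(A k).indicator (fun _ω => (1 : ℝ)) ω + q)
        ((‖(0:ℝ) - (-1)‖₊ / 2) ^ 2) μ := by
    intro k _
    have := hasSubgaussianMGF_of_mem_Icc (μ := μ) (a := -1) (b := 0)
      (X := fun ω => -(A k).indicator (fun _ω => (1 : ℝ)) ω)
      ((measurable_const.indicator (hA k)).neg.aemeasurable)
      (Filter.Eventually.of_forall fun ω => by
        by_cases h : ω ∈ A k <;> simp [h])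
    rw [hint k] at this
    simpa using this
  have h4 := HasSubgaussianMGF.measure_sum_ge_le_of_iIndepFun h2 h3
    (ε := L * q / 2) (by positivity)
  have hset : {ω | ∑ k, (A k).indicator (fun _ => (1:ℝ)) ω ≤ L * q / 2} =
      {ω | L * q / 2 ≤ ∑ k, (-(A k).indicator (fun _ω => (1 : ℝ)) ω + q)} := by
    ext ω
    simp only [Set.mem_setOf_eq, Finset.sum_add_distrib, Finset.sum_neg_distrib,
      Finset.sum_const, Finset.card_univ, Fintype.card_fin, nsmul_eq_mul]
    constructor <;> intro h <;> linarith
  rw [hset]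
  refine h4.trans (le_of_eq ?_)
  congr 1
  simp only [Finset.sum_const, Finset.card_univ, Fintype.card_fin, nsmul_eq_mul]
  push_cast
  rcases Nat.eq_zero_or_pos L with h | h
  · subst h; simp
  · have : (L:ℝ) ≠ 0 := by positivity
    norm_num
    field_simp
    norm_num

instance radMeasure_prob : IsProbabilityMeasure radMeasure := by
  constructor
  simp [radMeasure, ENNReal.inv_two_add_inv_two]

instance radPi_prob (d : ℕ) : IsProbabilityMeasure (radPi d) := by
  unfold radPi; infer_instance

def sg (b : Bool) : ℝ := if b then 1 else -1

lemma radMeasure_sg (b : Bool) : radMeasure {sg b} = 2⁻¹ := by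
  cases b <;> simp [radMeasure, sg] <;> norm_num

lemma radPi_abs (d : ℕ) : ∀ᵐ h ∂(radPi d), ∀ i, |h i| ≤ 1 := by
  rw [ae_all_iff]
  intro i
  have h1 : ∀ᵐ x ∂radMeasure, |x| ≤ 1 := by
    have hm : MeasurableSet {x : ℝ | |x| ≤ 1} := measurableSet_le (by fun_prop) (by fun_prop)
    unfold radMeasure
    rw [ae_add_measure_iff]
    constructor <;>
    · refine Measure.ae_smul_measure ?_ _
      rw [ae_dirac_iff hm]
      norm_num
  exact (measurePreserving_eval (fun _ : Fin d => radMeasure) i).quasiMeasurePreserving.ae h1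

def bidx (n m : ℕ) (p : Fin (n / m) × Fin m) : Fin (n + m - 1) :=
  ⟨m * p.1.1 + p.2.1, by
    have h1 := p.1.2
    have h2 := p.2.2
    have h3 : m * (p.1.1 + 1) ≤ m * (n / m) := Nat.mul_le_mul_left _ h1
    have h4 := Nat.mul_div_le n m
    rw [Nat.mul_add] at h3
    omega⟩

lemma bidx_inj (n m : ℕ) : Function.Injective (bidx n m) := by
  rintro ⟨⟨a, ha⟩, ⟨b, hb⟩⟩ ⟨⟨c, hc⟩, ⟨d, hd⟩⟩ h
  simp only [bidx, Fin.mk.injEq] at h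
  have hm : 0 < m := by omega
  have e1 : (m * a + b) / m = a := by
    rw [Nat.mul_add_div hm, Nat.div_eq_of_lt hb, add_zero]
  have e2 : (m * c + d) / m = c := by
    rw [Nat.mul_add_div hm, Nat.div_eq_of_lt hd, add_zero]
  have : a = c := by rw [← e1, ← e2, h]
  subst this
  have : b = d := by omega
  subst this
  rfl

def blockEv (n m : ℕ) (s : Fin m → Bool) (k : Fin (n / m)) : Set (Fin (n + m - 1) → ℝ) :=
  {h | ∀ j, h (bidx n m (k, j)) = sg (s j)}

lemma blockEv_meas (n m : ℕ) (s : Fin m → Bool) (k : Fin (n / m)) :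
    MeasurableSet (blockEv n m s k) := by
  unfold blockEv
  rw [Set.setOf_forall]
  exact MeasurableSet.iInter fun j =>
    measurableSet_eq_fun (by fun_prop) (by fun_prop)

lemma blockEv_inter (n m : ℕ) (s : Fin m → Bool) (S : Finset (Fin (n / m))) :
    radPi (n + m - 1) (⋂ k ∈ S, blockEv n m s k) = ∏ k ∈ S, (2⁻¹ : ENNReal) ^ m := by
  have h0 : iIndepFun (fun i (h : Fin (n + m - 1) → ℝ) => h i) (radPi (n + m - 1)) :=
    iIndepFun_pi (μ := fun _ : Fin (n + m - 1) => radMeasure) (X := fun _ x => x)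
      (fun _ => aemeasurable_id)
  have h1 := h0.precomp (bidx_inj n m)
  have h2 := h1.measure_inter_preimage_eq_mul (S ×ˢ Finset.univ)
    (sets := fun p => {sg (s p.2)}) (fun _ _ => measurableSet_singleton _)
  have hset : (⋂ k ∈ S, blockEv n m s k) = ⋂ p ∈ (S ×ˢ (Finset.univ : Finset (Fin m))),
      (fun h : Fin (n + m - 1) → ℝ => h (bidx n m p)) ⁻¹' {sg (s p.2)} := by
    ext h
    simp [blockEv]
    exact ⟨fun H a b ha => H a ha b, fun H a ha b => H a b ha⟩
  rw [hset, h2, Finset.prod_product]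
  refine Finset.prod_congr rfl fun k _ => ?_
  rw [Finset.prod_congr rfl (g := fun _ => (2⁻¹ : ENNReal))]
  · simp
  · intro j _
    have := (measurePreserving_eval (fun _ : Fin (n + m - 1) => radMeasure)
      (bidx n m (k, j))).measure_preimage (s := {sg (s j)})
        (measurableSet_singleton _).nullMeasurableSet
    rw [radMeasure_sg] at this
    exact this

lemma blockEv_bound (n m : ℕ) (s : Fin m → Bool) :
    (radPi (n + m - 1)).real {h | ∑ k, (blockEv n m s k).indicator (fun _ => (1:ℝ)) h
        ≤ (n / m : ℕ) * ((2:ℝ)⁻¹ ^ m) / 2}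
      ≤ Real.exp (-((n / m : ℕ) * ((2:ℝ)⁻¹ ^ m) ^ 2 / 2)) := by
  have h1 : ∀ k, radPi (n + m - 1) (blockEv n m s k) = (2⁻¹ : ENNReal) ^ m := by
    intro k
    simpa using blockEv_inter n m s {k}
  refine hoeff_aux _ _ _ (blockEv_meas n m s) ?_ _ (by positivity) ?_
  · rw [iIndepSet_iff_meas_biInter (blockEv_meas n m s)]
    intro S
    rw [blockEv_inter]
    exact Finset.prod_congr rfl fun k _ => (h1 k).symm
  · intro k
    simp [Measure.real, h1 k]

/-- deterministic part -/
lemma det_part (n m : ℕ) (h : Fin (n + m - 1) → ℝ) (habs : ∀ i, |h i| ≤ 1)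
    (c β : ℝ) (hc : 2 * (β * n) ≤ c)
    (hgood : ∀ s : Fin m → Bool, c < ∑ k, (blockEv n m s k).indicator (fun _ => (1:ℝ)) h)
    (x : Fin m → ℝ) (e : Fin n → ℝ) (he : (sparsity e : ℝ) ≤ β * n)
    (z : Fin m → ℝ) (hz : z ≠ x) :
    l1 ((toeplitz n m h).mulVec x + e - (toeplitz n m h).mulVec x) <
      l1 ((toeplitz n m h).mulVec x + e - (toeplitz n m h).mulVec z) := by
  classical
  set w : Fin m → ℝ := x - z with hw
  have hw0 : 0 < l1 w := by
    have : ∃ j, w j ≠ 0 := by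
      by_contra hcon
      push Not at hcon
      apply hz
      funext j
      have := hcon j
      simp only [hw, Pi.sub_apply] at this
      linarith
    obtain ⟨j, hj⟩ := this
    exact Finset.sum_pos' (fun i _ => abs_nonneg _) ⟨j, Finset.mem_univ _, abs_pos.2 hj⟩
  set v : Fin n → ℝ := (toeplitz n m h).mulVec w with hv
  have e1 : (toeplitz n m h).mulVec x + e - (toeplitz n m h).mulVec x = e := by
    abel
  have e2 : (toeplitz n m h).mulVec x + e - (toeplitz n m h).mulVec z = v + e := by
    rw [hv, hw, Matrix.mulVec_sub]; abel
  rw [e1, e2]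
  -- upper bound on each entry
  have hub : ∀ i, |v i| ≤ l1 w := by
    intro i
    simp only [hv, Matrix.mulVec, dotProduct, toeplitz]
    refine (Finset.abs_sum_le_sum_abs _ _).trans (Finset.sum_le_sum fun j _ => ?_)
    rw [abs_mul]
    exact mul_le_of_le_one_left (abs_nonneg _) (habs _)
  -- lower bound
  have hlb : c * l1 w < ∑ i, |v i| := by
    let s : Fin m → Bool := fun j => decide (0 ≤ w j)
    have hrow : ∀ k : Fin (n / m), m * k.1 < n ∨ m = 0 := by
      intro k
      rcases Nat.eq_zero_or_pos m with h0 | h0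
      · right; exact h0
      · left
        have h3 : m * (k.1 + 1) ≤ m * (n / m) := Nat.mul_le_mul_left _ k.2
        have h4 := Nat.mul_div_le n m
        rw [Nat.mul_add] at h3
        omega
    have hm0 : m ≠ 0 := by
      rintro rfl
      simp [l1] at hw0
    have hrow' : ∀ k : Fin (n / m), m * k.1 < n := fun k => (hrow k).resolve_right hm0
    let r : Fin (n / m) → Fin n := fun k => ⟨m * k.1, hrow' k⟩
    have hrinj : Function.Injective r := by
      intro a b hab
      simp only [r, Fin.mk.injEq] at hab
      exact Fin.ext (Nat.eq_of_mul_eq_mul_left (Nat.pos_of_ne_zero hm0) hab)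
    have hk : ∀ k, (blockEv n m s k).indicator (fun _ => (1:ℝ)) h * l1 w ≤ |v (r k)| := by
      intro k
      by_cases hmem : h ∈ blockEv n m s k
      · rw [Set.indicator_of_mem hmem, one_mul]
        refine le_trans (le_of_eq ?_) (le_abs_self _)
        simp only [hv, Matrix.mulVec, dotProduct, toeplitz, l1]
        refine Finset.sum_congr rfl fun j _ => ?_
        have := hmem j
        have h5 : h (⟨(r k).1 + j.1, by have := (r k).2; have := j.2; omega⟩) = sg (s j) := this
        rw [h5]
        by_cases hj : 0 ≤ w j
        · simp [s, sg, hj, abs_of_nonneg hj]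
        · simp [s, sg, hj, abs_of_neg (not_le.1 hj)]
      · rw [Set.indicator_of_notMem hmem, zero_mul]
        exact abs_nonneg _
    calc c * l1 w < (∑ k, (blockEv n m s k).indicator (fun _ => (1:ℝ)) h) * l1 w :=
          mul_lt_mul_of_pos_right (hgood s) hw0
      _ = ∑ k, (blockEv n m s k).indicator (fun _ => (1:ℝ)) h * l1 w := Finset.sum_mul _ _ _
      _ ≤ ∑ k, |v (r k)| := Finset.sum_le_sum fun k _ => hk k
      _ = ∑ i ∈ Finset.univ.map ⟨r, hrinj⟩, |v i| := by rw [Finset.sum_map]; rfl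
      _ ≤ ∑ i, |v i| := Finset.sum_le_sum_of_subset_of_nonneg (Finset.subset_univ _)
          (fun _ _ _ => abs_nonneg _)
  -- pointwise comparison
  have hpt : ∀ i, |e i| + |v i| - (if e i ≠ 0 then 2 * l1 w else 0) ≤ |v i + e i| := by
    intro i
    by_cases hi : e i = 0
    · simp [hi]
    · simp only [ne_eq, hi, not_false_eq_true, if_true]
      have h1 := hub i
      have h2 : |e i| ≤ |v i + e i| + |v i| := by
        have := abs_sub (v i + e i) (v i)
        simpa using this
      linarith
  have hsum := Finset.sum_le_sum fun i (_ : i ∈ (Finset.univ : Finset (Fin n))) => hpt i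
  rw [Finset.sum_sub_distrib, Finset.sum_add_distrib, ← Finset.sum_filter,
    Finset.sum_const, nsmul_eq_mul] at hsum
  have hsp : ((Finset.univ.filter fun i => e i ≠ 0).card : ℝ) ≤ β * n := by
    unfold sparsity at he
    convert he
  have h7 := mul_le_mul_of_nonneg_right hsp (by positivity : 0 ≤ 2 * l1 w)
  have h8 := mul_le_mul_of_nonneg_right hc hw0.le
  simp only [l1, Pi.add_apply] at *
  linarith

theorem stmt7 (m : ℕ) (hm : 1 ≤ m) :
    ∃ c₁ : ℝ, 0 < c₁ ∧ ∃ β : ℝ, 0 < β ∧ ∃ N : ℕ, ∀ n : ℕ, N ≤ n → m ≤ n →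
      ENNReal.ofReal (1 - Real.exp (-c₁ * n)) ≤
        radPi (n + m - 1)
          {h | ∀ x : Fin m → ℝ, ∀ e : Fin n → ℝ, (sparsity e : ℝ) ≤ β * n →
            ∀ z : Fin m → ℝ, z ≠ x →
              l1 ((toeplitz n m h).mulVec x + e - (toeplitz n m h).mulVec x) <
              l1 ((toeplitz n m h).mulVec x + e - (toeplitz n m h).mulVec z)} := by
  have hmR : (0:ℝ) < m := by exact_mod_cast hm
  set q : ℝ := (2:ℝ)⁻¹ ^ m with hq
  have hq0 : 0 < q := by positivity
  set c₁ : ℝ := q ^ 2 / (8 * m) with hc1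
  have hc0 : 0 < c₁ := by positivity
  refine ⟨c₁, hc0, q / (8 * m), by positivity, ⌈(2:ℝ) ^ m / c₁⌉₊, fun n hN hmn => ?_⟩
  have hdiv : (n:ℝ) / (2 * m) ≤ ((n / m : ℕ) : ℝ) := by
    have h1 : 1 ≤ n / m := (Nat.one_le_div_iff hm).2 hmn
    have h2 : n < m * (n / m + 1) := Nat.lt_mul_div_succ n hm
    have h3 : n ≤ (n / m) * (2 * m) := by nlinarith
    rw [div_le_iff₀ (by positivity)]
    exact_mod_cast h3
  set μ := radPi (n + m - 1) with hμ
  let bad : (Fin m → Bool) → Set (Fin (n + m - 1) → ℝ) := fun s =>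
    {h | ∑ k, (blockEv n m s k).indicator (fun _ => (1:ℝ)) h ≤ (n / m : ℕ) * q / 2}
  set good := {h | ∀ x : Fin m → ℝ, ∀ e : Fin n → ℝ, (sparsity e : ℝ) ≤ q / (8 * m) * n →
            ∀ z : Fin m → ℝ, z ≠ x →
              l1 ((toeplitz n m h).mulVec x + e - (toeplitz n m h).mulVec x) <
              l1 ((toeplitz n m h).mulVec x + e - (toeplitz n m h).mulVec z)} with hgood
  have hcover : ∀ᵐ h ∂μ, h ∈ (Set.univ : Set (Fin (n + m - 1) → ℝ)) →
      h ∈ good ∪ ⋃ s ∈ (Finset.univ : Finset (Fin m → Bool)), bad s := by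
    filter_upwards [radPi_abs (n + m - 1)] with h habs _
    by_cases hb : ∃ s, h ∈ bad s
    · right
      obtain ⟨s, hs⟩ := hb
      simp only [Set.mem_iUnion]
      exact ⟨s, Finset.mem_univ _, hs⟩
    · left
      push Not at hb
      intro x e he z hz
      refine det_part n m h habs ((n / m : ℕ) * q / 2) (q / (8 * m)) ?_ ?_ x e he z hz
      · have := mul_le_mul_of_nonneg_right hdiv (by positivity : 0 ≤ q / 2)
        refine le_trans (le_of_eq ?_) (this.trans (le_of_eq ?_))
        · field_simp; norm_num
        · ring
      · intro s
        exact not_le.1 (hb s)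
  have hprob : (1:ℝ) ≤ μ.real good + ∑ s : Fin m → Bool, μ.real (bad s) := by
    have h1 : μ Set.univ ≤ μ (good ∪ ⋃ s ∈ (Finset.univ : Finset (Fin m → Bool)), bad s) :=
      measure_mono_ae hcover
    have h2 : μ.real Set.univ ≤
        μ.real (good ∪ ⋃ s ∈ (Finset.univ : Finset (Fin m → Bool)), bad s) :=
      ENNReal.toReal_mono (measure_ne_top _ _) h1
    have h3 := measureReal_union_le (μ := μ) good
      (⋃ s ∈ (Finset.univ : Finset (Fin m → Bool)), bad s)
    have h4 := measureReal_biUnion_finset_le (μ := μ)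
      (Finset.univ : Finset (Fin m → Bool)) bad
    have h5 : μ.real Set.univ = 1 := by simp
    linarith
  have hbad : ∑ s : Fin m → Bool, μ.real (bad s) ≤ Real.exp (-c₁ * n) := by
    have hNn : (2:ℝ) ^ m ≤ c₁ * n := by
      have := Nat.ceil_le.1 hN
      rw [div_le_iff₀ hc0] at this
      linarith
    calc ∑ s : Fin m → Bool, μ.real (bad s)
        ≤ ∑ s : Fin m → Bool, Real.exp (-(2 * c₁ * n)) := by
          refine Finset.sum_le_sum fun s _ => (blockEv_bound n m s).trans ?_
          rw [Real.exp_le_exp, neg_le_neg_iff]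
          have := mul_le_mul_of_nonneg_right hdiv (by positivity : 0 ≤ q ^ 2 / 2)
          refine le_trans (le_of_eq ?_) (this.trans (le_of_eq ?_))
          · rw [hc1]; field_simp; norm_num
          · ring
      _ = (2:ℝ) ^ m * Real.exp (-(2 * c₁ * n)) := by simp
      _ ≤ Real.exp (c₁ * n) * Real.exp (-(2 * c₁ * n)) := by
          gcongr
          linarith [Real.add_one_le_exp (c₁ * n)]
      _ = Real.exp (-c₁ * n) := by
          rw [← Real.exp_add]; congr 1; ring
  rw [← ofReal_measureReal (measure_ne_top μ good)]
  exact ENNReal.ofReal_le_ofReal (by linarith)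
end
end
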